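/- arXiv:1004.4872 — 2 statements merged into one kernel-verified Lean document; each statement's English description precedes it below -/
import Mathlib

section
/- For every ε > 0 there exists x₀ such that for all real x ≥ x₀, S(x) ≥ (1 − ε) · x · (log log x) / log x. -/
/-- A Hadamard matrix of order `n`: an `n × n` real matrix with entries in `{-1, +1}`
satisfying `H * Hᵀ = n • I`. -/
def IsHadamardMatrix {n : ℕ} (H : Matrix (Fin n) (Fin n) ℝ) : Prop :=
  (∀ i j, H i j = 1 ∨ H i j = -1) ∧ H * H.transpose = (n : ℝ) • 1

/-- There exists a Hadamard matrix of order `n`. -/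
def HadamardOrder (n : ℕ) : Prop :=
  ∃ H : Matrix (Fin n) (Fin n) ℝ, IsHadamardMatrix H


/-- `S x` is the number of positive integers `n ≤ x` for which a Hadamard matrix
of order `n` exists. -/
noncomputable def S (x : ℝ) : ℕ :=
  {n : ℕ | 0 < n ∧ (n : ℝ) ≤ x ∧ HadamardOrder n}.ncard

/-! ### Constructions of Hadamard matrices -/

lemma HadamardOrder.of_fintype {ι : Type*} [Fintype ι] [DecidableEq ι] (H : Matrix ι ι ℝ)
    (hH : ∀ i j, H i j = 1 ∨ H i j = -1) (hmul : H * H.transpose = (Fintype.card ι : ℝ) • 1) :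
    HadamardOrder (Fintype.card ι) := by
  let e := Fintype.equivFin ι
  refine ⟨H.submatrix e.symm e.symm, fun i j => hH _ _, ?_⟩
  rw [Matrix.transpose_submatrix, Matrix.submatrix_mul_equiv, hmul, Matrix.submatrix_smul]
  simp

lemma hadamardOrder_one : HadamardOrder 1 :=
  ⟨1, fun i j => Or.inl (by rw [Subsingleton.elim i j, Matrix.one_apply_eq]), by simp⟩

lemma HadamardOrder.mul {m n : ℕ} (hm : HadamardOrder m) (hn : HadamardOrder n) :
    HadamardOrder (m * n) := by
  obtain ⟨A, hA, hA'⟩ := hm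
  obtain ⟨B, hB, hB'⟩ := hn
  have := HadamardOrder.of_fintype (Matrix.kroneckerMap (· * ·) A B) (fun i j => by
    rcases hA i.1 j.1 with h | h <;> rcases hB i.2 j.2 with h' | h' <;>
      simp [Matrix.kroneckerMap_apply, h, h']) (by
    rw [← Matrix.kroneckerMap_transpose, ← Matrix.mul_kronecker_mul, hA', hB',
      Matrix.smul_kronecker, Matrix.kronecker_smul, Matrix.one_kronecker_one, smul_smul]
    simp)
  simpa using this

/-- Paley's conference matrix attached to a finite field. -/
noncomputable def paleyConference (F : Type*) [Field F] [Fintype F] [DecidableEq F] :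
    Matrix (Option F) (Option F) ℝ
  | none, none => 0
  | none, some _ => 1
  | some _, none => (quadraticChar F (-1) : ℤ)
  | some a, some b => (quadraticChar F (a - b) : ℤ)

section Paley

variable {F : Type*} [Field F] [Fintype F] [DecidableEq F]

lemma sum_quadraticChar_sub (hF : ringChar F ≠ 2) (a : F) :
    ∑ b : F, quadraticChar F (a - b) = 0 := by
  rw [← quadraticChar_sum_zero hF]
  exact Fintype.sum_equiv (Equiv.subLeft a) _ _ fun b => rfl

lemma sum_quadraticChar_sub_mul (hF : ringChar F ≠ 2) {a b : F} (hab : a ≠ b) :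
    ∑ c : F, quadraticChar F (a - c) * quadraticChar F (b - c) = -1 := by
  have ht : b - a ≠ 0 := sub_ne_zero.mpr hab.symm
  have hJ := jacobiSum_nontrivial_inv (quadraticChar_ne_one hF)
  rw [(quadraticChar_isQuadratic F).inv, jacobiSum] at hJ
  have hs : quadraticChar F (-1) * quadraticChar F (-1) = 1 := by
    rw [← sq]; exact quadraticChar_sq_one (by simp)
  have ht2 : quadraticChar F (b - a) * quadraticChar F (b - a) = 1 := by
    rw [← sq]; exact quadraticChar_sq_one ht
  have key : ∑ c : F, quadraticChar F (a - c) * quadraticChar F (b - c) =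
      ∑ x : F, quadraticChar F (-1) * (quadraticChar F x * quadraticChar F (1 - x)) := by
    refine Fintype.sum_equiv ((Equiv.subRight a).trans (Equiv.divRight₀ (b - a) ht)) _ _ fun c => ?_
    have e1 : a - c = -1 * (b - a) * ((c - a) / (b - a)) := by field_simp; ring
    have e2 : b - c = (b - a) * (1 - (c - a) / (b - a)) := by field_simp; ring
    simp only [Equiv.trans_apply, Equiv.subRight_apply, Equiv.divRight₀_apply]
    rw [e1, e2]
    simp only [map_mul]
    linear_combination (quadraticChar F (-1) * quadraticChar F ((c - a) / (b - a)) *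
      quadraticChar F (1 - (c - a) / (b - a))) * ht2
  rw [key, ← Finset.mul_sum, hJ]
  linear_combination -hs

lemma quadraticChar_neg_one_mul_self : (quadraticChar F (-1) : ℝ) * quadraticChar F (-1) = 1 := by
  have : quadraticChar F (-1) ^ 2 = 1 := quadraticChar_sq_one (by simp)
  rw [← sq]; exact_mod_cast this

lemma paleyConference_transpose :
    (paleyConference F).transpose = (quadraticChar F (-1) : ℝ) • paleyConference F := by
  ext i j
  rcases i with _ | a <;> rcases j with _ | b
  · simp [paleyConference]
  · simp [paleyConference]
  · simp [-quadraticChar_apply, paleyConference, quadraticChar_neg_one_mul_self]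
  · simp only [Matrix.transpose_apply, Matrix.smul_apply, paleyConference, smul_eq_mul]
    rw [← neg_sub a b, ← neg_one_mul (a - b), map_mul]
    push_cast; ring

lemma paleyConference_mul_transpose (hF : ringChar F ≠ 2) :
    paleyConference F * (paleyConference F).transpose = (Fintype.card F : ℝ) • 1 := by
  ext i j
  rw [Matrix.mul_apply, Fintype.sum_option]
  rcases i with _ | a <;> rcases j with _ | b
  · simp [paleyConference]
  · have := sum_quadraticChar_sub hF b
    simp [paleyConference]
    exact_mod_cast this
  · have := sum_quadraticChar_sub hF a
    simp [paleyConference]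
    exact_mod_cast this
  · simp only [Matrix.transpose_apply, Matrix.smul_apply, paleyConference, smul_eq_mul,
      quadraticChar_neg_one_mul_self]
    by_cases hab : a = b
    · subst hab
      have h1 : ∀ c : F, (quadraticChar F (a - c) : ℝ) * (quadraticChar F (a - c)) =
          1 - if a = c then 1 else 0 := by
        intro c
        split_ifs with h
        · simp [h]
        · have : quadraticChar F (a - c) ^ 2 = 1 := quadraticChar_sq_one (sub_ne_zero.mpr h)
          rw [← sq, sub_zero]; exact_mod_cast this
      simp [-quadraticChar_apply, h1]
    · have := sum_quadraticChar_sub_mul hF hab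
      have h2 : ∑ c : F, (quadraticChar F (a - c) : ℝ) * (quadraticChar F (b - c)) = -1 := by
        exact_mod_cast this
      simp [-quadraticChar_apply, h2, hab]

lemma paleyConference_apply_self (i : Option F) : paleyConference F i i = 0 := by
  cases i <;> simp [paleyConference]

lemma quadraticChar_real_eq (a : F) (ha : a ≠ 0) :
    (quadraticChar F a : ℝ) = 1 ∨ (quadraticChar F a : ℝ) = -1 := by
  rcases quadraticChar_dichotomy ha with h | h <;> simp [h]

lemma paleyConference_apply_of_ne {i j : Option F} (h : i ≠ j) :
    paleyConference F i j = 1 ∨ paleyConference F i j = -1 := by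
  rcases i with _ | a <;> rcases j with _ | b
  · exact absurd rfl h
  · simp [paleyConference]
  · exact quadraticChar_real_eq _ (by simp)
  · exact quadraticChar_real_eq _ (sub_ne_zero.mpr fun e => h (by rw [e]))

lemma hadamardOrder_two_mul_card_add_one (hF : ringChar F ≠ 2) :
    HadamardOrder (2 * (Fintype.card F + 1)) := by
  set C := paleyConference F with hC
  set s : ℝ := (quadraticChar F (-1) : ℝ) with hs
  have hss : s * s = 1 := quadraticChar_neg_one_mul_self
  have hCt : C.transpose = s • C := paleyConference_transpose
  have hCC : s • (C * C) = (Fintype.card F : ℝ) • 1 := by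
    rw [← Matrix.mul_smul, ← hCt]; exact paleyConference_mul_transpose hF
  have hs1 : s = 1 ∨ s = -1 := quadraticChar_real_eq _ (by simp)
  have hpm : ∀ t u : ℝ, (t = 1 ∨ t = -1) → (u = 1 ∨ u = -1) → ∀ i j : Option F,
      (u • (C + t • 1)) i j = 1 ∨ (u • (C + t • 1)) i j = -1 := by
    intro t u ht hu i j
    by_cases hij : i = j
    · subst hij
      rcases ht with rfl | rfl <;> rcases hu with rfl | rfl <;>
        simp [hC, paleyConference_apply_self]
    · rcases paleyConference_apply_of_ne hij with h | h <;> rcases hu with rfl | rfl <;>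
        simp [hC, hij, h]
  have key := HadamardOrder.of_fintype
    (Matrix.fromBlocks ((1 : ℝ) • (C + (1 : ℝ) • 1)) ((1 : ℝ) • (C + (-s) • 1))
      ((1 : ℝ) • (C + (-s) • 1)) ((-1 : ℝ) • (C + (1 : ℝ) • 1))) (by
    have hns : -s = 1 ∨ -s = -1 := by rcases hs1 with h | h <;> simp [h]
    rintro (i | i) (j | j)
    · exact hpm 1 1 (by simp) (by simp) i j
    · exact hpm (-s) 1 hns (by simp) i j
    · exact hpm (-s) 1 hns (by simp) i j
    · exact hpm 1 (-1) (by simp) (by simp) i j) (by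
    rw [Matrix.fromBlocks_transpose, Matrix.fromBlocks_multiply]
    simp only [Matrix.transpose_smul, Matrix.transpose_add, hCt, Matrix.transpose_one,
      Matrix.smul_mul, Matrix.mul_smul, add_mul, mul_add, one_mul, mul_one, smul_smul, smul_add]
    rw [← Matrix.fromBlocks_one, Matrix.fromBlocks_smul]
    have hcard : (Fintype.card (Option F ⊕ Option F) : ℝ) = 2 * Fintype.card F + 2 := by
      simp; ring
    rw [hcard]
    congr 1
    · linear_combination (norm := module) (2 : ℝ) • hCC + hss • (1 - C)
    · linear_combination (norm := module) hss • C
    · linear_combination (norm := module) hss • (-C)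
    · linear_combination (norm := module) (2 : ℝ) • hCC + hss • (1 - C))
  have hcard : Fintype.card (Option F ⊕ Option F) = 2 * (Fintype.card F + 1) := by
    simp; ring
  rwa [hcard] at key

end Paley

lemma hadamardOrder_two_mul_prime_add_one {p : ℕ} (hp : p.Prime) (hp2 : p ≠ 2) :
    HadamardOrder (2 * (p + 1)) := by
  have := Fact.mk hp
  have := hadamardOrder_two_mul_card_add_one (F := ZMod p) (by rwa [ZMod.ringChar_zmod_n])
  rwa [ZMod.card] at this

/-! ### An upper bound sieve -/

open Finset in
lemma sum_range_mul_of_periodic {u v : ℕ} (huv : u.Coprime v) (hu : 0 < u) (hv : 0 < v)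
    {f g : ℕ → ℝ} (hf : f.Periodic u) (hg : g.Periodic v) :
    ∑ m ∈ range (u * v), f m * g m = (∑ m ∈ range u, f m) * ∑ m ∈ range v, g m := by
  rw [sum_mul_sum, ← sum_product']
  refine sum_nbij' (fun m => (m % u, m % v)) (fun x => (Nat.chineseRemainder huv x.1 x.2 : ℕ))
    ?_ ?_ ?_ ?_ ?_
  · intro m _
    simp [Nat.mod_lt _ hu, Nat.mod_lt _ hv]
  · intro x _
    exact mem_range.mpr (Nat.chineseRemainder_lt_mul huv _ _ hu.ne' hv.ne')
  · intro m hm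
    have h1 := (Nat.chineseRemainder huv (m % u) (m % v)).2
    refine Nat.ModEq.eq_of_lt_of_lt ((Nat.modEq_and_modEq_iff_modEq_mul huv).mp
      ⟨h1.1.trans (Nat.mod_modEq _ _), h1.2.trans (Nat.mod_modEq _ _)⟩)
      (Nat.chineseRemainder_lt_mul huv _ _ hu.ne' hv.ne') (mem_range.mp hm)
  · rintro ⟨x, y⟩ hx
    simp only [mem_product, mem_range] at hx
    have h1 := (Nat.chineseRemainder huv x y).2
    exact Prod.ext (Eq.trans h1.1 (Nat.mod_eq_of_lt hx.1)) (Eq.trans h1.2 (Nat.mod_eq_of_lt hx.2))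
  · intro m _
    simp only [hf.map_mod_nat, hg.map_mod_nat]

lemma periodic_prod_primes {U : Finset ℕ} {b : ℕ → ℕ → ℝ} (hb : ∀ p ∈ U, (b p).Periodic p) :
    Function.Periodic (fun m => ∏ p ∈ U, b p m) (∏ p ∈ U, p) := by
  intro m
  refine Finset.prod_congr rfl fun p hp => ?_
  obtain ⟨k, hk⟩ := Finset.dvd_prod_of_mem (fun p : ℕ => p) hp
  rw [hk, mul_comm]
  exact (hb p hp).nat_mul k m

open Finset in
lemma sum_range_prod_primes {U : Finset ℕ} (hU : ∀ p ∈ U, p.Prime) {b : ℕ → ℕ → ℝ}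
    (hb : ∀ p ∈ U, (b p).Periodic p) :
    ∑ m ∈ range (∏ p ∈ U, p), ∏ p ∈ U, b p m = ∏ p ∈ U, ∑ m ∈ range p, b p m := by
  induction U using Finset.induction_on with
  | empty => simp
  | insert q U hq ih =>
    have hU' : ∀ p ∈ U, p.Prime := fun p hp => hU p (mem_insert_of_mem hp)
    have hb' : ∀ p ∈ U, (b p).Periodic p := fun p hp => hb p (mem_insert_of_mem hp)
    have hqp := hU q (mem_insert_self _ _)
    simp only [prod_insert hq]
    rw [← ih hU' hb']
    refine sum_range_mul_of_periodic (f := b q) (g := fun m => ∏ p ∈ U, b p m)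
      (Nat.Coprime.prod_right fun p hp => ?_) hqp.pos
      (Finset.prod_pos fun p hp => (hU' p hp).pos) (hb q (mem_insert_self _ _))
      (periodic_prod_primes hb')
    exact (Nat.coprime_primes hqp (hU' p hp)).mpr fun e => hq (e ▸ hp)

open Finset in
lemma sum_range_le_of_periodic {f : ℕ → ℝ} {T : ℕ} (hT : 0 < T) (hf : f.Periodic T) {K : ℝ}
    (hK : ∀ m, |f m| ≤ K) (M : ℕ) :
    ∑ m ∈ range M, f m ≤ M / T * ∑ m ∈ range T, f m + 2 * T * K := by
  have hK0 : 0 ≤ K := (abs_nonneg _).trans (hK 0)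
  have hTr : (0 : ℝ) < T := by exact_mod_cast hT
  have hmul : ∀ q : ℕ, ∑ m ∈ range (q * T), f m = q * ∑ m ∈ range T, f m := by
    intro q
    induction q with
    | zero => simp
    | succ q ih =>
      rw [add_mul, one_mul, sum_range_add, ih]
      have : ∑ x ∈ range T, f (q * T + x) = ∑ x ∈ range T, f x :=
        sum_congr rfl fun x _ => by rw [add_comm]; exact hf.nat_mul q x
      rw [this]; push_cast; ring
  have hbd : ∀ (n : ℕ) (g : ℕ → ℝ), (∀ m, |g m| ≤ K) → |∑ m ∈ range n, g m| ≤ n * K := by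
    intro n g hg
    calc _ ≤ ∑ m ∈ range n, |g m| := abs_sum_le_sum_abs _ _
      _ ≤ ∑ m ∈ range n, K := sum_le_sum fun m _ => hg m
      _ = n * K := by simp
  have hM : M = M / T * T + M % T := (Nat.div_add_mod' M T).symm
  have hr : (M % T : ℕ) ≤ (T : ℝ) := by exact_mod_cast (Nat.mod_lt M hT).le
  have hsum : ∑ m ∈ range M, f m = (M / T : ℕ) * ∑ m ∈ range T, f m +
      ∑ m ∈ range (M % T), f (M / T * T + m) := by
    conv_lhs => rw [hM]
    rw [sum_range_add, hmul]
  have h1 := abs_le.mp (hbd (M % T) (fun m => f (M / T * T + m)) fun m => hK _)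
  have h2 := abs_le.mp (hbd T f hK)
  have hMr : (M : ℝ) / T = (M / T : ℕ) + (M % T : ℕ) / T := by
    rw [eq_comm]
    field_simp
    exact_mod_cast hM.symm
  rw [hsum, hMr]
  have h3 : -(T * K) ≤ (M % T : ℕ) / (T : ℝ) * ∑ m ∈ range T, f m := by
    have hq : (M % T : ℕ) / (T : ℝ) ≤ 1 := (div_le_one hTr).mpr hr
    have hq0 : 0 ≤ (M % T : ℕ) / (T : ℝ) := by positivity
    nlinarith [mul_nonneg hTr.le hK0]
  have h4 : (M % T : ℕ) * K ≤ T * K := mul_le_mul_of_nonneg_right hr hK0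
  linarith [h1.2]

/-- Sets of primes in `P` whose product is at most `R`. -/
def sievePrimeSets (P : Finset ℕ) (R : ℕ) : Finset (Finset ℕ) :=
  P.powerset.filter fun D => ∏ p ∈ D, p ≤ R

lemma mem_sievePrimeSets {P D : Finset ℕ} {R : ℕ} :
    D ∈ sievePrimeSets P R ↔ D ⊆ P ∧ ∏ p ∈ D, p ≤ R := by
  simp [sievePrimeSets]

lemma primeFactors_prod_primes {D : Finset ℕ} (hD : ∀ p ∈ D, p.Prime) :
    (∏ p ∈ D, p).primeFactors = D := Nat.primeFactors_prod hD

lemma card_sievePrimeSets_le {P : Finset ℕ} (hP : ∀ p ∈ P, p.Prime) (R : ℕ) :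
    (sievePrimeSets P R).card ≤ R := by
  have : (sievePrimeSets P R).card ≤ (Finset.Icc 1 R).card := by
    refine Finset.card_le_card_of_injOn (fun D => ∏ p ∈ D, p) ?_ ?_
    · intro D hD
      have hD := mem_sievePrimeSets.mp hD
      exact Finset.mem_coe.mpr (Finset.mem_Icc.mpr
        ⟨Finset.prod_pos fun p hp => (hP p (hD.1 hp)).pos, hD.2⟩)
    · intro D hD E hE h
      have hD := mem_sievePrimeSets.mp hD
      have hE := mem_sievePrimeSets.mp hE
      rw [← primeFactors_prod_primes fun p hp => hP p (hD.1 hp),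
        ← primeFactors_prod_primes fun p hp => hP p (hE.1 hp)]
      exact congrArg _ h
  simpa using this

open Finset in
/-- Dual form of Selberg's sieve: `c p` is a function of period `p`, equal to one on the sifted
set, with mean zero and mean square `V p`. -/
theorem card_sifted_mul_sq_le {P : Finset ℕ} (hP : ∀ p ∈ P, p.Prime) {c : ℕ → ℕ → ℝ} {V : ℕ → ℝ}
    (hper : ∀ p ∈ P, (c p).Periodic p) (hmean : ∀ p ∈ P, ∑ m ∈ range p, c p m = 0)
    (hsq : ∀ p ∈ P, ∑ m ∈ range p, c p m ^ 2 = p * V p) (hV : ∀ p ∈ P, 0 < V p)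
    (hbd : ∀ p ∈ P, ∀ m, |c p m| ≤ p * V p) (R M : ℕ) {s : Finset ℕ} (hs : s ⊆ range M)
    (hsc : ∀ m ∈ s, ∀ p ∈ P, c p m = 1) :
    s.card * (∑ D ∈ sievePrimeSets P R, ∏ p ∈ D, (V p)⁻¹) ^ 2 ≤
      M * (∑ D ∈ sievePrimeSets P R, ∏ p ∈ D, (V p)⁻¹) + 2 * R ^ 6 := by
  set 𝒟 := sievePrimeSets P R with h𝒟
  set g : Finset ℕ → ℝ := fun D => ∏ p ∈ D, (V p)⁻¹ with hg
  set f : Finset ℕ → ℕ → ℝ := fun D m => ∏ p ∈ D, c p m with hf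
  have hsub : ∀ D ∈ 𝒟, D ⊆ P := fun D hD => (mem_sievePrimeSets.mp hD).1
  have hR : ∀ D ∈ 𝒟, ((∏ p ∈ D, p : ℕ) : ℝ) ≤ R := fun D hD => by
    exact_mod_cast (mem_sievePrimeSets.mp hD).2
  have hgf : ∀ D ∈ 𝒟, ∀ m, |g D * f D m| ≤ R := by
    intro D hD m
    refine le_trans ?_ (hR D hD)
    rw [hg, hf, ← prod_mul_distrib, abs_prod]
    push_cast
    refine prod_le_prod (fun p _ => abs_nonneg _) fun p hp => ?_
    have hp' := hsub D hD hp
    rw [abs_mul, abs_of_pos (inv_pos.mpr (hV p hp')), inv_mul_le_iff₀ (hV p hp'), mul_comm]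
    exact hbd p hp' m
  have hpair : ∀ D ∈ 𝒟, ∀ E ∈ 𝒟, ∑ m ∈ range M, (g D * f D m) * (g E * f E m) ≤
      (if D = E then M * g D else 0) + 2 * R ^ 4 := by
    intro D hD E hE
    have hUP : D ∪ E ⊆ P := union_subset (hsub D hD) (hsub E hE)
    set b : ℕ → ℕ → ℝ := fun p m => (if p ∈ D then c p m else 1) * (if p ∈ E then c p m else 1)
      with hb
    have hbper : ∀ p ∈ D ∪ E, (b p).Periodic p := by
      intro p hp m
      simp only [hb, hper p (hUP hp) m]
    have hff : ∀ m, f D m * f E m = ∏ p ∈ D ∪ E, b p m := by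
      intro m
      simp only [hb, hf, prod_mul_distrib]
      rw [prod_ite_mem, prod_ite_mem, union_inter_cancel_left, union_inter_cancel_right]
    have hT : 0 < ∏ p ∈ D ∪ E, p := prod_pos fun p hp => (hP p (hUP hp)).pos
    have hTR : ((∏ p ∈ D ∪ E, p : ℕ) : ℝ) ≤ R ^ 2 := by
      have h1 : ∏ p ∈ D ∪ E, p ≤ (∏ p ∈ D, p) * ∏ p ∈ E, p := by
        rw [← prod_union_inter]
        exact Nat.le_mul_of_pos_right _
          (prod_pos fun p hp => (hP p (hsub D hD (mem_inter.mp hp).1)).pos)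
      calc ((∏ p ∈ D ∪ E, p : ℕ) : ℝ) ≤ ((∏ p ∈ D, p : ℕ) : ℝ) * (∏ p ∈ E, p : ℕ) := by
            exact_mod_cast h1
        _ ≤ R * R := mul_le_mul (hR D hD) (hR E hE) (by positivity) (by positivity)
        _ = R ^ 2 := (sq _).symm
    have hprod : ∀ m, (g D * f D m) * (g E * f E m) = g D * g E * ∏ p ∈ D ∪ E, b p m := by
      intro m; rw [← hff]; ring
    have hKbd : ∀ m, |(g D * f D m) * (g E * f E m)| ≤ R ^ 2 := by
      intro m
      rw [abs_mul, sq]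
      exact mul_le_mul (hgf D hD m) (hgf E hE m) (abs_nonneg _) (by positivity)
    have hperD : Function.Periodic (fun m => (g D * f D m) * (g E * f E m)) (∏ p ∈ D ∪ E, p) := by
      intro m
      simp only [hprod]
      have := periodic_prod_primes hbper m
      simp only at this
      rw [this]
    refine (sum_range_le_of_periodic hT hperD hKbd M).trans ?_
    refine add_le_add ?_ ?_
    · simp only [hprod]
      rw [← mul_sum, sum_range_prod_primes (fun p hp => hP p (hUP hp)) hbper]
      split_ifs with hDE
      · subst hDE
        have h1 : ∀ p ∈ D ∪ D, ∑ m ∈ range p, b p m = p * V p := by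
          intro p hp
          have hpD : p ∈ D := by simpa using hp
          rw [← hsq p (hUP hp)]
          exact sum_congr rfl fun m _ => by simp [hb, hpD, sq]
        rw [prod_congr rfl h1, union_idempotent, prod_mul_distrib]
        have h2 : (∏ p ∈ D, (p : ℝ)) ≠ 0 :=
          prod_ne_zero_iff.mpr fun p hp => by exact_mod_cast (hP p (hsub D hD hp)).ne_zero
        have h3 : g D * ∏ p ∈ D, V p = 1 := by
          rw [hg, ← prod_mul_distrib]
          exact prod_eq_one fun p hp => inv_mul_cancel₀ (hV p (hsub D hD hp)).ne'
        have h4 : (M : ℝ) / ((∏ p ∈ D, p : ℕ) : ℝ) *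
            (g D * g D * ((∏ p ∈ D, (p : ℝ)) * ∏ p ∈ D, V p)) =
            M * g D * (g D * ∏ p ∈ D, V p) := by
          push_cast
          field_simp
        rw [h4, h3, mul_one]
      · obtain ⟨p, hpU, hp0⟩ : ∃ p ∈ D ∪ E, ∑ m ∈ range p, b p m = 0 := by
          by_contra hcon
          push Not at hcon
          refine hDE (Finset.ext fun p => ?_)
          by_cases hpD : p ∈ D <;> by_cases hpE : p ∈ E
          · simp [hpD, hpE]
          · exact absurd (by simpa [hb, hpD, hpE] using hmean p (hsub D hD hpD))
              (hcon p (mem_union_left _ hpD))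
          · exact absurd (by simpa [hb, hpD, hpE] using hmean p (hsub E hE hpE))
              (hcon p (mem_union_right _ hpE))
          · simp [hpD, hpE]
        rw [prod_eq_zero (f := fun p => ∑ m ∈ range p, b p m) hpU hp0]
        simp
    · calc 2 * ((∏ p ∈ D ∪ E, p : ℕ) : ℝ) * (R : ℝ) ^ 2 ≤ 2 * (R : ℝ) ^ 2 * (R : ℝ) ^ 2 := by
            gcongr
        _ = 2 * (R : ℝ) ^ 4 := by ring
  have hupper : ∑ m ∈ range M, (∑ D ∈ 𝒟, g D * f D m) ^ 2 ≤ M * (∑ D ∈ 𝒟, g D) + 2 * R ^ 6 := by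
    calc ∑ m ∈ range M, (∑ D ∈ 𝒟, g D * f D m) ^ 2
        = ∑ D ∈ 𝒟, ∑ E ∈ 𝒟, ∑ m ∈ range M, (g D * f D m) * (g E * f E m) := by
          simp only [sq, sum_mul_sum]
          rw [sum_comm]
          exact sum_congr rfl fun D _ => sum_comm
      _ ≤ ∑ D ∈ 𝒟, ∑ E ∈ 𝒟, ((if D = E then M * g D else 0) + 2 * R ^ 4) :=
          sum_le_sum fun D hD => sum_le_sum fun E hE => hpair D hD E hE
      _ = M * (∑ D ∈ 𝒟, g D) + 𝒟.card * (𝒟.card * (2 * R ^ 4)) := by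
          simp [sum_add_distrib, mul_sum]
      _ ≤ M * (∑ D ∈ 𝒟, g D) + R * (R * (2 * R ^ 4)) := by
          have : (𝒟.card : ℝ) ≤ R := by exact_mod_cast card_sievePrimeSets_le hP R
          gcongr
      _ = _ := by ring
  refine le_trans ?_ hupper
  calc (s.card : ℝ) * (∑ D ∈ 𝒟, g D) ^ 2 = ∑ m ∈ s, (∑ D ∈ 𝒟, g D * f D m) ^ 2 := by
        rw [← nsmul_eq_mul, ← sum_const]
        refine sum_congr rfl fun m hm => ?_
        congr 1
        refine sum_congr rfl fun D hD => ?_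
        rw [hf]
        simp only
        rw [prod_eq_one fun p hp => hsc m hm p (hsub D hD hp), mul_one]
    _ ≤ _ := sum_le_sum_of_subset_of_nonneg hs fun m _ _ => sq_nonneg _

/-! ### Lower bounds for the sieve density -/

open Finset in
lemma sum_inv_le_prod_of_primeFactors_eq {A : Finset ℕ} (hA : ∀ p ∈ A, p.Prime) {N : Finset ℕ}
    (hN : ∀ n ∈ N, n ≠ 0 ∧ n.primeFactors = A) :
    ∑ n ∈ N, (1 : ℝ) / n ≤ ∏ p ∈ A, (1 : ℝ) / (p - 1) := by
  have hpos : 0 < ∏ p ∈ A, p := prod_pos fun p hp => (hA p hp).pos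
  let f : ℕ →* ℝ :=
    { toFun := fun n => (n : ℝ)⁻¹
      map_one' := by simp
      map_mul' := fun m n => by push_cast; exact mul_inv _ _ }
  obtain ⟨h1, h2⟩ := EulerProduct.summable_and_hasSum_factoredNumbers_prod_filter_prime_geometric
    (f := f) (fun {p} hp => by
      have : (1 : ℝ) < p := by exact_mod_cast hp.one_lt
      simp only [f, MonoidHom.coe_mk, OneHom.coe_mk, norm_inv, Real.norm_natCast]
      exact inv_lt_one_of_one_lt₀ this) A
  have hdvd : ∀ n ∈ N, (∏ p ∈ A, p) ∣ n := fun n hn => (hN n hn).2 ▸ Nat.prod_primeFactors_dvd n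
  have hmem : ∀ n ∈ N, n / (∏ p ∈ A, p) ∈ Nat.factoredNumbers A := by
    intro n hn
    have : n ∈ Nat.factoredNumbers A :=
      Nat.mem_factoredNumbers_of_primeFactors_subset (hN n hn).1 (hN n hn).2.le
    exact Nat.mem_factoredNumbers_of_dvd this (Nat.div_dvd_of_dvd (hdvd n hn))
  let e : N → Nat.factoredNumbers A := fun n => ⟨n.1 / ∏ p ∈ A, p, hmem n.1 n.2⟩
  have he : Function.Injective e := by
    intro m n hmn
    have h : m.1 / (∏ p ∈ A, p) = n.1 / ∏ p ∈ A, p := congrArg Subtype.val hmn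
    exact Subtype.ext (Nat.div_left_inj (hdvd _ m.2) (hdvd _ n.2) |>.mp h)
  have h3 : ∑ n : N, f (e n) ≤ ∏ p ∈ A with p.Prime, (1 - f p)⁻¹ := by
    have := sum_le_hasSum (f := fun m : Nat.factoredNumbers A => f m) ((univ : Finset N).map ⟨e, he⟩) (fun i _ => by simp [f]) h2
    simpa using this
  rw [filter_true_of_mem hA] at h3
  have h4 : ∑ n : N, f (e n) = (∏ p ∈ A, (p : ℝ)) * ∑ n ∈ N, (1 : ℝ) / n := by
    rw [mul_sum, ← sum_coe_sort N]
    refine sum_congr rfl fun n _ => ?_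
    simp only [f, e, MonoidHom.coe_mk, OneHom.coe_mk]
    rw [Nat.cast_div (hdvd _ n.2) (by exact_mod_cast hpos.ne')]
    push_cast
    rw [inv_div, mul_one_div]
  have h5 : ∏ p ∈ A, (1 - f p)⁻¹ = (∏ p ∈ A, (p : ℝ)) * ∏ p ∈ A, (1 : ℝ) / (p - 1) := by
    rw [← prod_mul_distrib]
    refine prod_congr rfl fun p hp => ?_
    have : (1 : ℝ) < p := by exact_mod_cast (hA p hp).one_lt
    have h1 : (p : ℝ) - 1 ≠ 0 := by linarith
    have h0 : (p : ℝ) ≠ 0 := by linarith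
    simp only [f, MonoidHom.coe_mk, OneHom.coe_mk]
    field_simp
  rw [h4, h5] at h3
  exact le_of_mul_le_mul_left h3 (prod_pos fun p hp => by exact_mod_cast (hA p hp).pos)

open Finset in
lemma log_le_sum_sievePrimeSets {P : Finset ℕ} {Q : ℕ}
    (hPQ : ∀ p, p.Prime → p ≤ Q → p ∈ P) (hP : ∀ p ∈ P, p.Prime) :
    Real.log (Q + 1) ≤ ∑ A ∈ sievePrimeSets P Q, ∏ p ∈ A, (1 : ℝ) / (p - 1) := by
  have h1 := log_add_one_le_harmonic Q
  rw [harmonic_eq_sum_Icc] at h1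
  push_cast at h1
  refine h1.trans ?_
  have hmaps : ∀ n ∈ Icc 1 Q, n.primeFactors ∈ sievePrimeSets P Q := by
    intro n hn
    rw [mem_Icc] at hn
    refine mem_sievePrimeSets.mpr ⟨fun p hp => ?_, ?_⟩
    · exact hPQ p (Nat.prime_of_mem_primeFactors hp)
        ((Nat.le_of_mem_primeFactors hp).trans hn.2)
    · exact (Nat.le_of_dvd hn.1 (Nat.prod_primeFactors_dvd n)).trans hn.2
  rw [← sum_fiberwise_of_maps_to hmaps]
  refine sum_le_sum fun A hA => ?_
  simp only [← one_div]
  refine sum_inv_le_prod_of_primeFactors_eq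
    (fun p hp => hP p ((mem_sievePrimeSets.mp hA).1 hp)) fun n hn => ?_
  simp only [mem_filter, mem_Icc] at hn
  exact ⟨by omega, hn.2⟩

open Finset in
lemma prod_one_add_one_div_sub_one_le (s : Finset ℕ) (hs : ∀ n ∈ s, 2 ≤ n) :
    ∏ n ∈ s, (1 + (1 : ℝ) / (n - 1)) ≤ s.card + 1 := by
  induction s using Finset.induction_on_max with
  | empty => simp
  | insert m s hm ih =>
    have hms : m ∉ s := fun h => lt_irrefl _ (hm m h)
    have hm2 : 2 ≤ m := hs m (mem_insert_self _ _)
    have hcard : s.card ≤ m - 2 := by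
      have : s ⊆ Ico 2 m := fun x hx => mem_Ico.mpr ⟨hs x (mem_insert_of_mem hx), hm x hx⟩
      simpa using card_le_card this
    have hc : (s.card : ℝ) + 2 ≤ m := by
      have : s.card + 2 ≤ m := by omega
      exact_mod_cast this
    rw [prod_insert hms, card_insert_of_notMem hms]
    have ih' := ih fun n hn => hs n (mem_insert_of_mem hn)
    have hpos : (0 : ℝ) ≤ s.card := by positivity
    have h1 : (1 : ℝ) + 1 / (m - 1) ≤ (s.card + 2) / (s.card + 1) := by
      have : (0 : ℝ) < s.card + 1 := by linarith
      have h2 : (1 : ℝ) / (m - 1) ≤ 1 / (s.card + 1) :=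
        one_div_le_one_div_of_le this (by linarith)
      calc _ ≤ 1 + (1 : ℝ) / (s.card + 1) := by linarith
        _ = _ := by field_simp; ring
    calc _ ≤ ((s.card : ℝ) + 2) / (s.card + 1) * (s.card + 1) :=
          mul_le_mul h1 ih' (prod_nonneg fun n hn => by
            have : (2 : ℝ) ≤ n := by exact_mod_cast hs n (mem_insert_of_mem hn)
            have : (0 : ℝ) ≤ 1 / (n - 1) := one_div_nonneg.mpr (by linarith)
            linarith) (by positivity)
      _ = _ := by field_simp; push_cast; ring

open Finset in
lemma sum_sievePrimeSets_le_mul {P B : Finset ℕ} {h : ℕ → ℝ} (hh : ∀ p ∈ P, 0 ≤ h p)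
    (hP : ∀ p ∈ P, p ≠ 0) (hBP : B ⊆ P) (Q : ℕ) :
    ∑ A ∈ sievePrimeSets P Q, ∏ p ∈ A, h p ≤
      (∑ A ∈ sievePrimeSets (P \ B) Q, ∏ p ∈ A, h p) * ∏ p ∈ B, (1 + h p) := by
  rw [prod_one_add, sum_mul_sum, ← sum_product']
  have hinj : Set.InjOn (fun A : Finset ℕ => (A \ B, A ∩ B)) (sievePrimeSets P Q) := by
    intro A _ A' _ hAA
    simp only [Prod.mk.injEq] at hAA
    rw [← sdiff_union_inter A B, ← sdiff_union_inter A' B, hAA.1, hAA.2]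
  have heq : ∑ A ∈ sievePrimeSets P Q, ∏ p ∈ A, h p =
      ∑ x ∈ (sievePrimeSets P Q).image (fun A : Finset ℕ => (A \ B, A ∩ B)),
        (∏ p ∈ x.1, h p) * ∏ p ∈ x.2, h p := by
    rw [sum_image hinj]
    exact sum_congr rfl fun A _ => by
      rw [mul_comm]; exact (prod_inter_mul_prod_sdiff A B h).symm
  rw [heq]
  refine sum_le_sum_of_subset_of_nonneg ?_ ?_
  · intro x hx
    obtain ⟨A, hA, rfl⟩ := mem_image.mp hx
    have hA := mem_sievePrimeSets.mp hA
    refine mem_product.mpr ⟨mem_sievePrimeSets.mpr ⟨sdiff_subset_sdiff hA.1 le_rfl, ?_⟩,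
      mem_powerset.mpr inter_subset_right⟩
    exact (Nat.le_of_dvd (Nat.pos_of_ne_zero (prod_ne_zero_iff.mpr fun p hp => hP p (hA.1 hp)))
      (prod_dvd_prod_of_subset _ _ _ sdiff_subset)).trans hA.2
  · intro x hx _
    rw [mem_product, mem_sievePrimeSets, mem_powerset] at hx
    exact mul_nonneg (prod_nonneg fun p hp => hh p (sdiff_subset (hx.1.1 hp)))
      (prod_nonneg fun p hp => hh p (hBP (hx.2 hp)))

open Finset in
lemma sum_filter_union_eq_prod (D : Finset ℕ) (h : ℕ → ℝ) :
    ∑ x ∈ (D.powerset ×ˢ D.powerset).filter (fun x => x.1 ∪ x.2 = D),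
      (∏ p ∈ x.1, h p) * ∏ p ∈ x.2, h p = ∏ p ∈ D, (h p * (1 + h p) + h p) := by
  rw [prod_add]
  have : ∀ A ∈ D.powerset, (∏ p ∈ A, h p * (1 + h p)) * ∏ p ∈ D \ A, h p =
      ∑ C ∈ A.powerset, (∏ p ∈ A, h p) * ∏ p ∈ C ∪ (D \ A), h p := by
    intro A hA
    rw [prod_mul_distrib, prod_one_add, ← mul_sum, mul_assoc, sum_mul]
    congr 1
    refine sum_congr rfl fun C hC => ?_
    rw [prod_union]
    exact disjoint_sdiff.mono_left (mem_powerset.mp hC)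
  rw [sum_congr rfl this, sum_sigma' D.powerset (fun A => A.powerset)
    (fun A C => (∏ p ∈ A, h p) * ∏ p ∈ C ∪ (D \ A), h p)]
  refine sum_nbij' (fun x => ⟨x.1, x.1 ∩ x.2⟩) (fun x => (x.1, x.2 ∪ (D \ x.1))) ?_ ?_ ?_ ?_ ?_
  · rintro ⟨A, B⟩ hx
    simp only [mem_filter, mem_product, mem_powerset, mem_sigma] at hx ⊢
    exact ⟨hx.1.1, inter_subset_left⟩
  · rintro ⟨A, C⟩ hx
    simp only [mem_filter, mem_product, mem_powerset, mem_sigma] at hx ⊢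
    refine ⟨⟨hx.1, union_subset (hx.2.trans hx.1) sdiff_subset⟩, ?_⟩
    ext p
    have h1 := @hx.1 p
    have h2 := @hx.2 p
    simp only [mem_union, mem_sdiff]
    tauto
  · rintro ⟨A, B⟩ hx
    simp only [mem_filter, mem_product, mem_powerset] at hx
    refine Prod.ext rfl (Finset.ext fun p => ?_)
    have h1 := @hx.1.1 p
    have h2 := @hx.1.2 p
    have h3 := Finset.ext_iff.mp hx.2 p
    simp only [mem_union, mem_sdiff, mem_inter] at h3 ⊢
    tauto
  · rintro ⟨A, C⟩ hx
    simp only [mem_powerset, mem_sigma] at hx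
    have : A ∩ (C ∪ D \ A) = C := by
      ext p
      have h2 := @hx.2 p
      simp only [mem_union, mem_sdiff, mem_inter]
      tauto
    simp [this]
  · rintro ⟨A, B⟩ hx
    simp only [mem_filter, mem_product, mem_powerset] at hx
    have : A ∩ B ∪ D \ A = B := by
      ext p
      have h2 := @hx.1.2 p
      have h3 := Finset.ext_iff.mp hx.2 p
      simp only [mem_union, mem_sdiff, mem_inter] at h3 ⊢
      tauto
    simp [this]

open Finset in
lemma sq_sum_sievePrimeSets_le {P : Finset ℕ} (hP : ∀ p ∈ P, p.Prime) {h g : ℕ → ℝ}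
    (hh : ∀ p ∈ P, 0 ≤ h p) (hg : ∀ p ∈ P, h p * (1 + h p) + h p ≤ g p) {Q R : ℕ}
    (hQR : Q ^ 2 ≤ R) :
    (∑ A ∈ sievePrimeSets P Q, ∏ p ∈ A, h p) ^ 2 ≤ ∑ D ∈ sievePrimeSets P R, ∏ p ∈ D, g p := by
  rw [sq, sum_mul_sum, ← sum_product']
  have hmaps : ∀ x ∈ sievePrimeSets P Q ×ˢ sievePrimeSets P Q,
      x.1 ∪ x.2 ∈ sievePrimeSets P R := by
    intro x hx
    rw [mem_product, mem_sievePrimeSets, mem_sievePrimeSets] at hx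
    refine mem_sievePrimeSets.mpr ⟨union_subset hx.1.1 hx.2.1, ?_⟩
    calc ∏ p ∈ x.1 ∪ x.2, p ≤ (∏ p ∈ x.1 ∪ x.2, p) * ∏ p ∈ x.1 ∩ x.2, p :=
          Nat.le_mul_of_pos_right _
            (prod_pos fun p hp => (hP p (hx.1.1 (mem_inter.mp hp).1)).pos)
      _ = (∏ p ∈ x.1, p) * ∏ p ∈ x.2, p := prod_union_inter
      _ ≤ Q * Q := Nat.mul_le_mul hx.1.2 hx.2.2
      _ ≤ R := by rwa [← sq]
  rw [← sum_fiberwise_of_maps_to hmaps]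
  refine sum_le_sum fun D hD => ?_
  have hDP := (mem_sievePrimeSets.mp hD).1
  calc _ ≤ ∑ x ∈ (D.powerset ×ˢ D.powerset).filter (fun x => x.1 ∪ x.2 = D),
        (∏ p ∈ x.1, h p) * ∏ p ∈ x.2, h p := by
        refine sum_le_sum_of_subset_of_nonneg ?_ ?_
        · intro x hx
          simp only [mem_filter, mem_product, mem_powerset] at hx ⊢
          exact ⟨⟨hx.2 ▸ subset_union_left, hx.2 ▸ subset_union_right⟩, hx.2⟩
        · intro x hx _
          simp only [mem_filter, mem_product, mem_powerset] at hx
          exact mul_nonneg (prod_nonneg fun p hp => hh p (hDP (hx.1.1 hp)))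
            (prod_nonneg fun p hp => hh p (hDP (hx.1.2 hp)))
    _ = ∏ p ∈ D, (h p * (1 + h p) + h p) := sum_filter_union_eq_prod D h
    _ ≤ ∏ p ∈ D, g p := prod_le_prod (fun p hp => by
        have := hh p (hDP hp); positivity) fun p hp => hg p (hDP hp)

/-! ### Pairs of linear forms taking prime values -/

lemma two_pow_card_primeFactors_le {n : ℕ} (hn : n ≠ 0) : 2 ^ n.primeFactors.card ≤ n := by
  calc 2 ^ n.primeFactors.card = ∏ _p ∈ n.primeFactors, 2 := by simp
    _ ≤ ∏ p ∈ n.primeFactors, p :=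
        Finset.prod_le_prod' fun p hp => (Nat.prime_of_mem_primeFactors hp).two_le
    _ ≤ n := Nat.le_of_dvd (Nat.pos_of_ne_zero hn) (Nat.prod_primeFactors_dvd n)

open Finset in
lemma card_filter_range_linear {p : ℕ} (hp : p.Prime) {a b : ℕ} (ha : ¬ p ∣ a) (hb : ¬ p ∣ b)
    (hab : (a : ZMod p) ≠ b) :
    ((range p).filter fun m : ℕ =>
      (a : ZMod p) * m = 1 ∨ (b : ZMod p) * m = 1).card = 2 := by
  have := Fact.mk hp
  have ha' : (a : ZMod p) ≠ 0 := by rwa [Ne, ZMod.natCast_eq_zero_iff]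
  have hb' : (b : ZMod p) ≠ 0 := by rwa [Ne, ZMod.natCast_eq_zero_iff]
  have heq : ((range p).filter fun m : ℕ => (a : ZMod p) * m = 1 ∨ (b : ZMod p) * m = 1) =
      {((a : ZMod p)⁻¹).val, ((b : ZMod p)⁻¹).val} := by
    ext m
    simp only [mem_filter, mem_range, mem_insert, mem_singleton]
    constructor
    · rintro ⟨hm, h | h⟩
      · left
        rw [← eq_inv_of_mul_eq_one_right h, ZMod.val_cast_of_lt hm]
      · right
        rw [← eq_inv_of_mul_eq_one_right h, ZMod.val_cast_of_lt hm]
    · rintro (rfl | rfl)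
      · exact ⟨ZMod.val_lt _, Or.inl (by rw [ZMod.natCast_zmod_val, mul_inv_cancel₀ ha'])⟩
      · exact ⟨ZMod.val_lt _, Or.inr (by rw [ZMod.natCast_zmod_val, mul_inv_cancel₀ hb'])⟩
  rw [heq, card_pair]
  intro h
  exact hab (inv_injective (ZMod.val_injective p h))

lemma le_of_mul_sq_le_of_div_le {s M K L G E : ℝ} (hM : 0 ≤ M) (hL : 0 < L) (hE : 0 ≤ E)
    (hK : 0 < K) (hs : s * G ^ 2 ≤ M * G + E) (hG1 : 1 ≤ G) (hG : L / K ≤ G) :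
    s ≤ M * K / L + E := by
  have hG0 : 0 < G := by linarith
  have h1 : s ≤ M / G + E / G ^ 2 := by
    rw [← mul_le_mul_iff_left₀ (pow_pos hG0 2)]
    refine hs.trans (le_of_eq ?_)
    field_simp
  have h2 : M / G ≤ M * K / L := by
    rw [div_le_div_iff₀ hG0 hL, mul_assoc]
    rw [div_le_iff₀ hK] at hG
    exact mul_le_mul_of_nonneg_left (by linarith) hM
  have h3 : E / G ^ 2 ≤ E := div_le_self hE (one_le_pow₀ hG1)
  linarith

set_option maxHeartbeats 1000000 in
open Finset in
theorem card_prime_pairs_le {a b : ℕ} (ha : 0 < a) (hb : 0 < b) (hab : a ≠ b) {R Q : ℕ}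
    (hQR : Q ^ 2 ≤ R) (hQ : 0 < Q) (M : ℕ) :
    (((range M).filter fun m => (a * m - 1).Prime ∧ (b * m - 1).Prime).card : ℝ) ≤
      M * ((a * b * ((a : ℤ) - b).natAbs).primeFactors.card + 1) ^ 2 / Real.log (Q + 1) ^ 2 +
        2 * R ^ 6 + (R + 2) := by
  classical
  set N := a * b * ((a : ℤ) - b).natAbs with hN
  have hN0 : N ≠ 0 := by
    have : ((a : ℤ) - b).natAbs ≠ 0 := by omega
    positivity
  set P₀ := (range (R + 1)).filter Nat.Prime with hP₀
  set B := P₀.filter (· ∣ N) with hB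
  set P := P₀ \ B with hPdef
  have hP₀p : ∀ p ∈ P₀, p.Prime := fun p hp => (mem_filter.mp hp).2
  have hP : ∀ p ∈ P, p.Prime := fun p hp => hP₀p p (sdiff_subset hp)
  have hPR : ∀ p ∈ P, p ≤ R := fun p hp => by
    have := mem_range.mp (mem_filter.mp (sdiff_subset hp)).1
    omega
  have hPN : ∀ p ∈ P, ¬ p ∣ N := fun p hp h => by
    rw [hPdef, mem_sdiff] at hp
    exact hp.2 (mem_filter.mpr ⟨hp.1, h⟩)
  have hpa : ∀ p ∈ P, ¬ p ∣ a := fun p hp h => hPN p hp (by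
    rw [hN, mul_assoc]; exact h.mul_right _)
  have hpb : ∀ p ∈ P, ¬ p ∣ b := fun p hp h => hPN p hp ((h.mul_left _).mul_right _)
  have hpab : ∀ p ∈ P, ¬ p ∣ ((a : ℤ) - b).natAbs := fun p hp h => hPN p hp (h.mul_left _)
  have hp3 : ∀ p ∈ P, 3 ≤ p := by
    intro p hp
    have h2 := (hP p hp).two_le
    have hp2 : p ≠ 2 := by
      rintro rfl
      have h1 := hpa 2 hp
      have h2 := hpb 2 hp
      have h3 := hpab 2 hp
      omega
    omega
  have hp3r : ∀ p ∈ P, (3 : ℝ) ≤ p := fun p hp => by exact_mod_cast hp3 p hp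
  set V : ℕ → ℝ := fun p => ((p : ℝ) - 2) / 2 with hV
  set c : ℕ → ℕ → ℝ := fun p m =>
    if (a : ZMod p) * m = 1 ∨ (b : ZMod p) * m = 1 then -V p else 1 with hc
  have hcard : ∀ p ∈ P, ((range p).filter fun m : ℕ =>
      (a : ZMod p) * m = 1 ∨ (b : ZMod p) * m = 1).card = 2 := by
    intro p hp
    refine card_filter_range_linear (hP p hp) (hpa p hp) (hpb p hp) fun h => hpab p hp ?_
    have h' : (((a : ℤ) - b : ℤ) : ZMod p) = 0 := by push_cast; rw [h, sub_self]
    rw [ZMod.intCast_zmod_eq_zero_iff_dvd] at h'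
    exact Int.natCast_dvd.mp h'
  have hcard' : ∀ p ∈ P, ((((range p).filter fun m : ℕ =>
      ¬ ((a : ZMod p) * m = 1 ∨ (b : ZMod p) * m = 1)).card : ℕ) : ℝ) = p - 2 := by
    intro p hp
    have := card_filter_add_card_filter_not (s := range p)
      (fun m : ℕ => (a : ZMod p) * m = 1 ∨ (b : ZMod p) * m = 1)
    rw [hcard p hp, card_range] at this
    rw [eq_sub_iff_add_eq, add_comm]
    exact_mod_cast this
  set s := (range M).filter fun m => R + 1 < m ∧ (a * m - 1).Prime ∧ (b * m - 1).Prime with hs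
  have hkey : ∀ p ∈ P, ∀ a m : ℕ, 0 < a → R + 1 < m → (a * m - 1).Prime →
      (a : ZMod p) * m ≠ 1 := by
    intro p hp a m ha hm hpr h
    have h1 : m ≤ a * m := Nat.le_mul_of_pos_left m ha
    have h2 : ((a * m - 1 : ℕ) : ZMod p) = 0 := by
      rw [Nat.cast_sub (by omega)]
      push_cast
      rw [h, sub_self]
    rw [ZMod.natCast_eq_zero_iff] at h2
    have h3 := (Nat.prime_dvd_prime_iff_eq (hP p hp) hpr).mp h2
    have h4 := hPR p hp
    omega
  have hsieve := card_sifted_mul_sq_le hP (c := c) (V := V) (s := s)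
    (fun p hp m => by simp only [hc]; push_cast; simp)
    (fun p hp => by
      simp only [hc]
      rw [sum_ite, sum_const, sum_const, nsmul_eq_mul, nsmul_eq_mul, hcard p hp, hcard' p hp]
      simp only [hV]; push_cast; ring)
    (fun p hp => by
      simp only [hc, ite_pow]
      rw [sum_ite, sum_const, sum_const, nsmul_eq_mul, nsmul_eq_mul, hcard p hp, hcard' p hp]
      simp only [hV]; push_cast; ring)
    (fun p hp => by
      have := hp3r p hp
      simp only [hV]; linarith)
    (fun p hp m => by
      have := hp3r p hp
      have hVp : 0 ≤ V p := by simp only [hV]; linarith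
      simp only [hc]
      split_ifs
      · rw [abs_neg, abs_of_nonneg hVp]; nlinarith
      · rw [abs_one]; simp only [hV]; nlinarith)
    R M (filter_subset _ _)
    (fun m hm p hp => by
      rw [hs, mem_filter] at hm
      simp only [hc]
      rw [if_neg]
      rintro (h | h)
      · exact hkey p hp a m ha hm.2.1 hm.2.2.1 h
      · exact hkey p hp b m hb hm.2.1 hm.2.2.2 h)
  set G := ∑ D ∈ sievePrimeSets P R, ∏ p ∈ D, (V p)⁻¹ with hG
  set k := N.primeFactors.card with hk
  set h : ℕ → ℝ := fun p => (1 : ℝ) / (p - 1) with hh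
  have hQ' : Q ≤ R := (Nat.le_self_pow two_ne_zero Q).trans hQR
  set W := ∑ A ∈ sievePrimeSets P Q, ∏ p ∈ A, h p with hW
  have hh0 : ∀ p ∈ P₀, 0 ≤ h p := fun p hp => by
    have : (1 : ℝ) < p := by exact_mod_cast (hP₀p p hp).one_lt
    exact one_div_nonneg.mpr (by linarith)
  have hL0 : 0 < Real.log (Q + 1) := Real.log_pos (by
    have : (0 : ℝ) < Q := by exact_mod_cast hQ
    linarith)
  have hlog : Real.log (Q + 1) ≤ W * (k + 1) := by
    have h1 := log_le_sum_sievePrimeSets (P := P₀) (Q := Q)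
      (fun p hp hpQ => mem_filter.mpr ⟨mem_range.mpr (by omega), hp⟩) hP₀p
    refine h1.trans ((sum_sievePrimeSets_le_mul hh0 (fun p hp => (hP₀p p hp).ne_zero)
      (filter_subset (· ∣ N) P₀) Q).trans ?_)
    have hB2 := prod_one_add_one_div_sub_one_le B fun p hp =>
      (hP₀p p (mem_filter.mp hp).1).two_le
    have hBk : (B.card : ℝ) ≤ k := by
      have : B ⊆ N.primeFactors := fun p hp => by
        rw [hB, mem_filter] at hp
        exact Nat.mem_primeFactors.mpr ⟨hP₀p p hp.1, hp.2, hN0⟩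
      exact_mod_cast card_le_card this
    have hW0 : 0 ≤ W := sum_nonneg fun A hA => prod_nonneg fun p hp =>
      hh0 p (sdiff_subset ((mem_sievePrimeSets.mp hA).1 hp))
    exact mul_le_mul_of_nonneg_left (hB2.trans (by linarith)) hW0
  have hWG : W ^ 2 ≤ G := by
    refine sq_sum_sievePrimeSets_le hP (fun p hp => hh0 p (sdiff_subset hp)) (fun p hp => ?_) hQR
    have := hp3r p hp
    have h1 : (0 : ℝ) < p - 1 := by linarith
    have h2 : (0 : ℝ) < p - 2 := by linarith
    simp only [hh, hV]
    rw [inv_div, ← sub_nonneg]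
    have : (2 : ℝ) / (p - 2) - (1 / (p - 1) * (1 + 1 / (p - 1)) + 1 / (p - 1)) =
        p / ((p - 2) * (p - 1) ^ 2) := by
      field_simp; ring
    rw [this]
    positivity
  have hG1 : 1 ≤ G := by
    have hmem : ∅ ∈ sievePrimeSets P R :=
      mem_sievePrimeSets.mpr ⟨empty_subset _, by rw [prod_empty]; exact hQ.trans_le hQ'⟩
    have := single_le_sum (f := fun D => ∏ p ∈ D, (V p)⁻¹) (fun D hD => prod_nonneg fun p hp => ?_)
      hmem
    · simp only [prod_empty] at this
      exact this
    · have := hp3r p ((mem_sievePrimeSets.mp hD).1 hp)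
      simp only [hV]
      exact inv_nonneg.mpr (by linarith)
  have hk0 : (0 : ℝ) < k + 1 := by positivity
  have hGlow : Real.log (Q + 1) ^ 2 / (k + 1) ^ 2 ≤ G := by
    refine le_trans ?_ hWG
    rw [← div_pow]
    exact pow_le_pow_left₀ (by positivity) ((div_le_iff₀ hk0).mpr hlog) 2
  have hs_le : (s.card : ℝ) ≤ M * (k + 1) ^ 2 / Real.log (Q + 1) ^ 2 + 2 * R ^ 6 :=
    le_of_mul_sq_le_of_div_le (Nat.cast_nonneg M) (pow_pos hL0 2) (by positivity)
      (pow_pos hk0 2) hsieve hG1 hGlow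
  have hsplit : ((range M).filter fun m => (a * m - 1).Prime ∧ (b * m - 1).Prime).card ≤
      s.card + (R + 2) := by
    rw [← card_range (R + 2)]
    refine (card_le_card ?_).trans (card_union_le _ _)
    intro m hm
    rw [mem_filter] at hm
    by_cases hmR : R + 1 < m
    · exact mem_union_left _ (mem_filter.mpr ⟨hm.1, hmR, hm.2⟩)
    · exact mem_union_right _ (mem_range.mpr (by omega))
  have hsplit' : (((range M).filter fun m => (a * m - 1).Prime ∧ (b * m - 1).Prime).card : ℝ) ≤
      s.card + (R + 2) := by exact_mod_cast hsplit
  linarith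

/-! ### Multiples of Hadamard orders by `2 (p + 1)` -/

open Finset in
lemma sum_card_le_card_biUnion_add {ι α : Type*} [DecidableEq ι] [DecidableEq α]
    (K : Finset ι) (A : ι → Finset α) :
    ∑ h ∈ K, (A h).card ≤
      (K.biUnion A).card + ∑ h ∈ K, ∑ h' ∈ K.erase h, (A h ∩ A h').card := by
  set B : ι → Finset α := fun h => A h \ (K.erase h).biUnion A with hB
  have hdisj : (K : Set ι).PairwiseDisjoint B := by
    intro h hh h' hh' hne
    rw [Function.onFun, disjoint_left]
    intro n hn hn'
    simp only [hB, mem_sdiff, mem_biUnion, not_exists, not_and] at hn hn'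
    exact hn.2 h' (mem_erase.mpr ⟨hne.symm, hh'⟩) hn'.1
  have hsub : K.biUnion B ⊆ K.biUnion A :=
    biUnion_mono fun h _ => sdiff_subset
  have h1 : ∑ h ∈ K, (B h).card ≤ (K.biUnion A).card := by
    rw [← card_biUnion hdisj]
    exact card_le_card hsub
  have h2 : ∀ h ∈ K, (A h).card ≤ (B h).card + ∑ h' ∈ K.erase h, (A h ∩ A h').card := by
    intro h _
    refine (card_le_card ?_ : (A h).card ≤
      (B h ∪ (K.erase h).biUnion fun h' => A h ∩ A h').card).trans
      ((card_union_le _ _).trans (Nat.add_le_add_left card_biUnion_le _))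
    intro n hn
    by_cases hx : n ∈ (K.erase h).biUnion A
    · obtain ⟨h', hh', hn'⟩ := mem_biUnion.mp hx
      exact mem_union_right _ (mem_biUnion.mpr ⟨h', hh', mem_inter.mpr ⟨hn, hn'⟩⟩)
    · exact mem_union_left _ (mem_sdiff.mpr ⟨hn, hx⟩)
  calc _ ≤ ∑ h ∈ K, ((B h).card + ∑ h' ∈ K.erase h, (A h ∩ A h').card) := sum_le_sum h2
    _ ≤ _ := by rw [sum_add_distrib]; exact Nat.add_le_add_right h1 _

/-- The integers `2 (p + 1) h ≤ X` with `p` an odd prime. -/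
def primeMultiples (X h : ℕ) : Finset ℕ :=
  ((Finset.range (X / (2 * h))).filter fun p => p.Prime ∧ p ≠ 2).image fun p => 2 * (p + 1) * h

lemma mem_primeMultiples {X h n : ℕ} (hh : 0 < h) : n ∈ primeMultiples X h ↔
    ∃ p, p.Prime ∧ p ≠ 2 ∧ 2 * (p + 1) * h = n ∧ n ≤ X := by
  simp only [primeMultiples, Finset.mem_image, Finset.mem_filter, Finset.mem_range]
  have key : ∀ p, p < X / (2 * h) ↔ 2 * (p + 1) * h ≤ X := fun p => by
    rw [← Nat.succ_le_iff, Nat.le_div_iff_mul_le (by omega), Nat.succ_eq_add_one]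
    ring_nf
  constructor
  · rintro ⟨p, ⟨hp, hp1, hp2⟩, rfl⟩
    exact ⟨p, hp1, hp2, rfl, (key p).mp hp⟩
  · rintro ⟨p, hp1, hp2, rfl, hX⟩
    exact ⟨p, ⟨(key p).mpr hX, hp1, hp2⟩, rfl⟩

lemma card_primeMultiples {X h : ℕ} (hh : 0 < h) : (primeMultiples X h).card =
    ((Finset.range (X / (2 * h))).filter fun p => p.Prime ∧ p ≠ 2).card := by
  refine Finset.card_image_of_injective _ fun p q hpq => ?_
  have := Nat.eq_of_mul_eq_mul_right hh hpq
  omega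

lemma HadamardOrder.of_mem_primeMultiples {X h n : ℕ} (hh : 0 < h) (hH : HadamardOrder h)
    (hn : n ∈ primeMultiples X h) : 0 < n ∧ n ≤ X ∧ HadamardOrder n := by
  obtain ⟨p, hp, hp2, rfl, hX⟩ := (mem_primeMultiples hh).mp hn
  exact ⟨by positivity, hX, (hadamardOrder_two_mul_prime_add_one hp hp2).mul hH⟩

open Finset in
lemma primeMultiples_inter_subset {X g a b : ℕ} (hg : 0 < g) (ha : 0 < a) (hb : 0 < b)
    (hab : a.Coprime b) :
    primeMultiples X (g * a) ∩ primeMultiples X (g * b) ⊆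
      ((range (X / (2 * (g * a * b)) + 1)).filter fun m =>
        (a * m - 1).Prime ∧ (b * m - 1).Prime).image fun m => 2 * (g * a * b) * m := by
  intro n hn
  rw [mem_inter, mem_primeMultiples (by positivity), mem_primeMultiples (by positivity)] at hn
  obtain ⟨⟨p, hp, -, hpn, hX⟩, ⟨q, hq, -, hqn, -⟩⟩ := hn
  have heq : (p + 1) * a = (q + 1) * b := by
    refine Nat.eq_of_mul_eq_mul_left (show 0 < 2 * g by positivity) ?_
    calc 2 * g * ((p + 1) * a) = n := by rw [← hpn]; ring
      _ = 2 * g * ((q + 1) * b) := by rw [← hqn]; ring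
  obtain ⟨m, hm⟩ : b ∣ p + 1 :=
    hab.symm.dvd_of_dvd_mul_right (heq ▸ Dvd.intro_left (q + 1) rfl)
  have hm' : q + 1 = a * m := by
    refine Nat.eq_of_mul_eq_mul_right hb ?_
    rw [← heq, hm]; ring
  have hn' : n = 2 * (g * a * b) * m := by rw [← hpn, hm]; ring
  refine mem_image.mpr ⟨m, mem_filter.mpr ⟨mem_range.mpr ?_, ?_, ?_⟩, hn'.symm⟩
  · rw [Nat.lt_succ_iff, Nat.le_div_iff_mul_le (by positivity), mul_comm, ← hn']
    exact hX
  · rwa [← hm', Nat.add_sub_cancel]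
  · rwa [← hm, Nat.add_sub_cancel]

lemma card_primeFactors_add_one_le {a b Y : ℕ} (ha : 0 < a) (hb : 0 < b) (hab : a ≠ b)
    (haY : a ≤ Y) (hbY : b ≤ Y) :
    ((a * b * ((a : ℤ) - b).natAbs).primeFactors.card : ℝ) + 1 ≤ 5 * Real.log Y + 1 := by
  have hd : ((a : ℤ) - b).natAbs ≠ 0 := by omega
  have h1 := two_pow_card_primeFactors_le
    (show a * b * ((a : ℤ) - b).natAbs ≠ 0 by positivity)
  have h2 : a * b * ((a : ℤ) - b).natAbs ≤ Y ^ 3 := by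
    rw [pow_succ, sq]
    exact Nat.mul_le_mul (Nat.mul_le_mul haY hbY) (by omega)
  have h3 : ((2 : ℝ)) ^ (a * b * ((a : ℤ) - b).natAbs).primeFactors.card ≤ (Y : ℝ) ^ 3 := by
    exact_mod_cast h1.trans h2
  have h4 := Real.log_le_log (by positivity) h3
  rw [Real.log_pow, Real.log_pow] at h4
  have h5 := Real.log_two_gt_d9
  have h6 : (0 : ℝ) ≤ (a * b * ((a : ℤ) - b).natAbs).primeFactors.card := Nat.cast_nonneg _
  push_cast at h4
  nlinarith

open Finset in
lemma card_primeMultiples_inter_le {X Y Q g a b : ℕ} (hg : 0 < g) (ha : 0 < a) (hb : 0 < b)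
    (hab : a.Coprime b) (hne : a ≠ b) (haY : a ≤ Y) (hbY : b ≤ Y) (hQ : 0 < Q) :
    ((primeMultiples X (g * a) ∩ primeMultiples X (g * b)).card : ℝ) ≤
      X * (5 * Real.log Y + 1) ^ 2 / Real.log (Q + 1) ^ 2 *
        ((g : ℝ)⁻¹ * ((a : ℝ)⁻¹ * (b : ℝ)⁻¹)) +
      ((5 * Real.log Y + 1) ^ 2 / Real.log (Q + 1) ^ 2 + 2 * Q ^ 12 + Q ^ 2 + 2) := by
  have hcard := (card_le_card (primeMultiples_inter_subset (X := X) hg ha hb hab)).trans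
    card_image_le
  have hcard' := (Nat.cast_le (α := ℝ)).mpr hcard
  refine hcard'.trans ((card_prime_pairs_le ha hb hne le_rfl hQ _).trans ?_)
  have hk := card_primeFactors_add_one_le ha hb hne haY hbY
  set k : ℝ := ((a * b * ((a : ℤ) - b).natAbs).primeFactors.card : ℝ)
  have hk0 : 0 ≤ k := Nat.cast_nonneg _
  have hk2 : (k + 1) ^ 2 ≤ (5 * Real.log Y + 1) ^ 2 := pow_le_pow_left₀ (by linarith) hk 2
  have hM : ((X / (2 * (g * a * b)) + 1 : ℕ) : ℝ) ≤
      X * ((g : ℝ)⁻¹ * ((a : ℝ)⁻¹ * (b : ℝ)⁻¹)) + 1 := by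
    have h1 : ((X / (2 * (g * a * b)) : ℕ) : ℝ) ≤ (X : ℝ) / ((2 * (g * a * b) : ℕ) : ℝ) :=
      Nat.cast_div_le
    have h2 : (X : ℝ) / ((2 * (g * a * b) : ℕ) : ℝ) =
        (X * ((g : ℝ)⁻¹ * ((a : ℝ)⁻¹ * (b : ℝ)⁻¹))) / 2 := by
      push_cast
      field_simp
    have h3 : 0 ≤ X * ((g : ℝ)⁻¹ * ((a : ℝ)⁻¹ * (b : ℝ)⁻¹)) := by positivity
    push_cast
    push_cast at h1 h2
    linarith
  have hmain := div_le_div_of_nonneg_right (c := Real.log (Q + 1) ^ 2)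
    (mul_le_mul hM hk2 (by positivity) (by positivity)) (by positivity)
  refine (add_le_add_left (add_le_add_left hmain _) _).trans (le_of_eq ?_)
  push_cast
  ring

open Finset in
lemma sum_erase_card_inter_le {X Y Q : ℕ} (hQ : 0 < Q) {K : Finset ℕ} (hK : K ⊆ Icc 1 Y) :
    ((∑ h ∈ K, ∑ h' ∈ K.erase h, (primeMultiples X h ∩ primeMultiples X h').card : ℕ) : ℝ) ≤
      X * (5 * Real.log Y + 1) ^ 2 / Real.log (Q + 1) ^ 2 * (1 + Real.log Y) ^ 3 +
      Y ^ 2 * ((5 * Real.log Y + 1) ^ 2 / Real.log (Q + 1) ^ 2 + 2 * Q ^ 12 + Q ^ 2 + 2) := by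
  set C : ℝ := X * (5 * Real.log Y + 1) ^ 2 / Real.log (Q + 1) ^ 2 with hC
  set E : ℝ := (5 * Real.log Y + 1) ^ 2 / Real.log (Q + 1) ^ 2 + 2 * Q ^ 12 + Q ^ 2 + 2 with hE
  have hC0 : 0 ≤ C := by positivity
  have hE0 : 0 ≤ E := by positivity
  set I := Icc 1 Y with hI
  set F : ℕ × ℕ → ℕ × ℕ × ℕ := fun q =>
    (q.1.gcd q.2, q.1 / q.1.gcd q.2, q.2 / q.1.gcd q.2) with hF
  set w : ℕ × ℕ × ℕ → ℝ := fun t => (t.1 : ℝ)⁻¹ * ((t.2.1 : ℝ)⁻¹ * (t.2.2 : ℝ)⁻¹) with hw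
  have hmem : ∀ q ∈ I ×ˢ I, F q ∈ I ×ˢ I ×ˢ I := by
    intro q hq
    simp only [hI, hF, mem_product, mem_Icc] at hq ⊢
    have hgpos : 0 < q.1.gcd q.2 := Nat.gcd_pos_of_pos_left _ hq.1.1
    have hg1 := Nat.le_of_dvd hq.1.1 (Nat.gcd_dvd_left q.1 q.2)
    have hg2 := Nat.le_of_dvd hq.2.1 (Nat.gcd_dvd_right q.1 q.2)
    exact ⟨⟨hgpos, hg1.trans hq.1.2⟩,
      ⟨Nat.div_pos hg1 hgpos, (Nat.div_le_self _ _).trans hq.1.2⟩,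
      ⟨Nat.div_pos hg2 hgpos, (Nat.div_le_self _ _).trans hq.2.2⟩⟩
  have hFinj : Set.InjOn F (I ×ˢ I : Finset (ℕ × ℕ)) := by
    intro q _ r _ hqr
    simp only [hF, Prod.mk.injEq] at hqr
    obtain ⟨h1, h2, h3⟩ := hqr
    refine Prod.ext ?_ ?_
    · rw [← Nat.mul_div_cancel' (Nat.gcd_dvd_left q.1 q.2), h2, h1,
        Nat.mul_div_cancel' (Nat.gcd_dvd_left r.1 r.2)]
    · rw [← Nat.mul_div_cancel' (Nat.gcd_dvd_right q.1 q.2), h3, h1,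
        Nat.mul_div_cancel' (Nat.gcd_dvd_right r.1 r.2)]
  have hterm : ∀ q ∈ I ×ˢ I, q.1 ≠ q.2 →
      ((primeMultiples X q.1 ∩ primeMultiples X q.2).card : ℝ) ≤ C * w (F q) + E := by
    intro q hq hne
    have hm := hmem q hq
    simp only [hI, hF, mem_product, mem_Icc] at hm
    have e1 := Nat.mul_div_cancel' (Nat.gcd_dvd_left q.1 q.2)
    have e2 := Nat.mul_div_cancel' (Nat.gcd_dvd_right q.1 q.2)
    have := card_primeMultiples_inter_le (X := X) hm.1.1 hm.2.1.1 hm.2.2.1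
      (Nat.coprime_div_gcd_div_gcd hm.1.1) (fun h => hne (by rw [← e1, h, e2]))
      hm.2.1.2 hm.2.2.2 hQ
    rw [e1, e2] at this
    exact this
  have hharm : ∑ n ∈ I, (n : ℝ)⁻¹ ≤ 1 + Real.log Y := by
    have := harmonic_le_one_add_log Y
    rw [harmonic_eq_sum_Icc] at this
    push_cast at this
    exact this
  have hharm0 : 0 ≤ ∑ n ∈ I, (n : ℝ)⁻¹ := sum_nonneg fun n _ => by positivity
  have hw3 : ∑ q ∈ I ×ˢ I, w (F q) ≤ (1 + Real.log Y) ^ 3 := by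
    rw [← sum_image (f := w) hFinj]
    calc ∑ t ∈ (I ×ˢ I).image F, w t ≤ ∑ t ∈ I ×ˢ I ×ˢ I, w t :=
          sum_le_sum_of_subset_of_nonneg (image_subset_iff.mpr hmem)
            fun t _ _ => by positivity
      _ = (∑ n ∈ I, (n : ℝ)⁻¹) ^ 3 := by
          simp only [hw, sum_product, ← mul_sum, ← sum_mul]
          ring
      _ ≤ _ := pow_le_pow_left₀ hharm0 hharm 3
  have hsumE : ∑ _q ∈ I ×ˢ I, E = Y ^ 2 * E := by
    rw [sum_const, nsmul_eq_mul, card_product, hI, Nat.card_Icc]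
    push_cast
    simp [sq]
  push_cast
  calc ∑ h ∈ K, ∑ h' ∈ K.erase h, ((primeMultiples X h ∩ primeMultiples X h').card : ℝ)
      ≤ ∑ h ∈ K, ∑ h' ∈ K.erase h, (C * w (F (h, h')) + E) :=
        sum_le_sum fun h hh => sum_le_sum fun h' hh' =>
          hterm (h, h') (mem_product.mpr ⟨hK hh, hK (mem_of_mem_erase hh')⟩)
            (ne_of_mem_erase hh').symm
    _ ≤ ∑ h ∈ I, ∑ h' ∈ I, (C * w (F (h, h')) + E) := by
        have hnn : ∀ q, 0 ≤ C * w q + E := fun q => by positivity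
        refine (sum_le_sum fun h _ => sum_le_sum_of_subset_of_nonneg
          ((erase_subset h K).trans hK) fun h' _ _ => hnn _).trans ?_
        exact sum_le_sum_of_subset_of_nonneg hK fun h _ _ => sum_nonneg fun h' _ => hnn _
    _ = C * ∑ q ∈ I ×ˢ I, w (F q) + Y ^ 2 * E := by
        rw [← sum_product', sum_add_distrib, ← mul_sum, hsumE]
    _ ≤ _ := by gcongr

/-! ### From the logarithmic density of Hadamard orders to their counting function -/

open Filter in
lemma eventually_le_card_odd_primes : ∀ᶠ M : ℕ in atTop, (M : ℝ) / (2 * Real.log M) ≤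
    (((Finset.range M).filter fun p => p.Prime ∧ p ≠ 2).card : ℝ) := by
  have hlog : ∀ᶠ M : ℕ in atTop, Real.log (M : ℝ) ≤ 1 / 100 * (M : ℝ) := by
    have := (Real.isLittleO_log_id_atTop.comp_tendsto
      (tendsto_natCast_atTop_atTop (R := ℝ))).bound (show (0 : ℝ) < 1 / 100 by norm_num)
    filter_upwards [this] with M hM
    simp only [Function.comp_apply, id, Real.norm_eq_abs, Nat.abs_cast] at hM
    exact (le_abs_self _).trans hM
  filter_upwards [hlog, eventually_ge_atTop 100] with M hM hM100
  have hM100' : (100 : ℝ) ≤ M := by exact_mod_cast hM100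
  have hL : 0 < Real.log M := Real.log_pos (by linarith)
  have hsucc : Real.log (M + 1) ≤ Real.log M + 1 := by
    have h1 : (M : ℝ) + 1 ≤ M * Real.exp 1 := by
      have := Real.add_one_le_exp (1 : ℝ)
      nlinarith
    have h2 := Real.log_le_log (by positivity) h1
    rwa [Real.log_mul (by positivity) (by positivity), Real.log_exp] at h2
  have hpi := Chebyshev.pi_ge M
  rw [div_le_iff₀ hL] at hpi
  have hcard : Nat.primeCounting M ≤
      ((Finset.range M).filter fun p => p.Prime ∧ p ≠ 2).card + 2 := by
    rw [Nat.primeCounting, Nat.primeCounting', Nat.count_eq_card_filter_range]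
    refine (Finset.card_le_card (?_ : _ ⊆
      ((Finset.range M).filter fun p => p.Prime ∧ p ≠ 2) ∪ {2, M})).trans
      ((Finset.card_union_le _ _).trans (Nat.add_le_add_left Finset.card_le_two _))
    intro p hp
    simp only [Finset.mem_filter, Finset.mem_range, Finset.mem_union, Finset.mem_insert,
      Finset.mem_singleton] at hp ⊢
    by_cases h2 : p = 2
    · exact Or.inr (Or.inl h2)
    · by_cases h3 : p = M
      · exact Or.inr (Or.inr h3)
      · exact Or.inl ⟨by omega, hp.2, h2⟩
  have hcard' : (Nat.primeCounting M : ℝ) ≤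
      (((Finset.range M).filter fun p => p.Prime ∧ p ≠ 2).card : ℝ) + 2 := by
    exact_mod_cast hcard
  rw [div_le_iff₀ (by positivity)]
  have h5 := Real.log_two_gt_d9
  nlinarith

lemma card_le_S {x : ℝ} {s : Finset ℕ}
    (hs : ∀ n ∈ s, 0 < n ∧ n ≤ ⌊x⌋₊ ∧ HadamardOrder n) : s.card ≤ S x := by
  rw [← Set.ncard_coe_finset]
  refine Set.ncard_le_ncard (fun n hn => ?_)
    ((Set.finite_Iic ⌊x⌋₊).subset fun n hn => Nat.le_floor hn.2.1)
  obtain ⟨h1, h2, h3⟩ := hs n hn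
  exact ⟨h1, (Nat.le_floor_iff' h1.ne').mp h2, h3⟩

open Filter Finset in
lemma exists_sum_card_primeMultiples_ge : ∃ N : ℝ, ∀ (x : ℝ) (Y : ℕ) (K : Finset ℕ),
    1 ≤ Y → N * Y ≤ x → K ⊆ Icc 1 Y →
    x / (8 * Real.log x) * ∑ h ∈ K, (h : ℝ)⁻¹ ≤
      ((∑ h ∈ K, (primeMultiples ⌊x⌋₊ h).card : ℕ) : ℝ) := by
  obtain ⟨N₀, hN₀⟩ := eventually_atTop.mp eventually_le_card_odd_primes
  refine ⟨4 * N₀ + 8, fun x Y K hY hx hK => ?_⟩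
  have hY' : (1 : ℝ) ≤ Y := by exact_mod_cast hY
  have hN₀' : (0 : ℝ) ≤ N₀ := Nat.cast_nonneg _
  have hx8 : 8 ≤ x := by nlinarith
  have hlx : 0 < Real.log x := Real.log_pos (by linarith)
  push_cast
  rw [mul_sum]
  refine sum_le_sum fun h hh => ?_
  obtain ⟨hh1, hhY⟩ := mem_Icc.mp (hK hh)
  have hh1' : (1 : ℝ) ≤ h := by exact_mod_cast hh1
  have hhY' : (h : ℝ) ≤ Y := by exact_mod_cast hhY
  have hhx : (4 * N₀ + 8) * (h : ℝ) ≤ x := by nlinarith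
  rw [card_primeMultiples hh1]
  set M := ⌊x⌋₊ / (2 * h) with hM
  have hMlow : x / (4 * h) ≤ M := by
    have h1 : ⌊x⌋₊ < 2 * h * (M + 1) := by
      rw [hM, mul_add, mul_one]
      exact Nat.lt_mul_div_succ _ (by omega)
    have h1' : (⌊x⌋₊ : ℝ) + 1 ≤ 2 * h * (M + 1) := by exact_mod_cast h1
    have h2 := Nat.lt_floor_add_one x
    rw [div_le_iff₀ (by positivity)]
    nlinarith
  have hMN : N₀ ≤ M := by
    have : (N₀ : ℝ) ≤ M := by
      refine le_trans ?_ hMlow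
      rw [le_div_iff₀ (by positivity)]
      nlinarith
    exact_mod_cast this
  have hMx : (M : ℝ) ≤ x := by
    refine le_trans ?_ (Nat.floor_le (by linarith : 0 ≤ x))
    exact_mod_cast Nat.div_le_self _ _
  have hM2 : 2 ≤ (M : ℝ) := by
    refine le_trans ?_ hMlow
    rw [le_div_iff₀ (by positivity)]
    nlinarith
  have hlM : 0 < Real.log M := Real.log_pos (by linarith)
  refine le_trans ?_ (hN₀ M hMN)
  calc x / (8 * Real.log x) * (h : ℝ)⁻¹ = x / (4 * h) / (2 * Real.log x) := by
        field_simp; norm_num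
    _ ≤ M / (2 * Real.log M) := by
        gcongr

lemma collision_bound_le {v x X LY L y Q : ℝ} (hv : 21 ≤ v) (hx : x = Real.exp (v ^ 10))
    (hX : X ≤ x) (hLY0 : 0 ≤ LY) (hLY : LY ≤ v) (hL : v ^ 10 / 20 ≤ L)
    (hy0 : 0 ≤ y) (hy : y ≤ Real.exp v) (hQ0 : 0 ≤ Q) (hQ : Q ≤ Real.exp (v ^ 10 / 20)) :
    X * (5 * LY + 1) ^ 2 / L ^ 2 * (1 + LY) ^ 3 +
      y ^ 2 * ((5 * LY + 1) ^ 2 / L ^ 2 + 2 * Q ^ 12 + Q ^ 2 + 2) ≤ x / (16 * v ^ 10) := by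
  have hv0 : 0 < v := by linarith
  have hx0 : 0 < x := hx ▸ Real.exp_pos _
  have hL0 : 0 < L := lt_of_lt_of_le (by positivity) hL
  have hk : (5 * LY + 1) ^ 2 / L ^ 2 ≤ 14400 / v ^ 18 := by
    calc (5 * LY + 1) ^ 2 / L ^ 2 ≤ (6 * v) ^ 2 / (v ^ 10 / 20) ^ 2 := by
          gcongr; linarith
      _ = 14400 / v ^ 18 := by field_simp; norm_num
  have h1 : X * (5 * LY + 1) ^ 2 / L ^ 2 * (1 + LY) ^ 3 ≤ x / (32 * v ^ 10) := by
    calc X * (5 * LY + 1) ^ 2 / L ^ 2 * (1 + LY) ^ 3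
        = X * ((5 * LY + 1) ^ 2 / L ^ 2) * (1 + LY) ^ 3 := by ring
      _ ≤ x * (14400 / v ^ 18) * (2 * v) ^ 3 := by gcongr; linarith
      _ = x * 115200 / (v ^ 10 * v ^ 5) := by field_simp; norm_num
      _ ≤ x / (32 * v ^ 10) := by
          have : (21 : ℝ) ^ 5 ≤ v ^ 5 := by gcongr
          rw [div_le_div_iff₀ (by positivity) (by positivity)]
          have h2 : (115200 : ℝ) * 32 ≤ v ^ 5 := by linarith
          calc x * 115200 * (32 * v ^ 10) = x * v ^ 10 * (115200 * 32) := by ring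
            _ ≤ x * v ^ 10 * v ^ 5 := by gcongr
            _ = x * (v ^ 10 * v ^ 5) := by ring
  set u := v ^ 10 with hu
  have hu9 : (21 : ℝ) ^ 9 * v ≤ u := by
    rw [hu, pow_succ v 9]
    have : (21 : ℝ) ^ 9 ≤ v ^ 9 := by gcongr
    exact mul_le_mul_of_nonneg_right this hv0.le
  have hu1 : (5000 : ℝ) ≤ u := by linarith
  have h3 : 14400 / v ^ 18 ≤ 1 := by
    rw [div_le_one (by positivity)]
    calc (14400 : ℝ) ≤ 21 ^ 18 := by norm_num
      _ ≤ v ^ 18 := by gcongr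
  set e := Real.exp (u / 20) with he
  have he1 : 1 ≤ e := Real.one_le_exp (by positivity)
  have h4 : 14400 / v ^ 18 + 2 * Q ^ 12 + Q ^ 2 + 2 ≤ 6 * e ^ 12 := by
    have ha : Q ^ 12 ≤ e ^ 12 := pow_le_pow_left₀ hQ0 hQ 12
    have hb : Q ^ 2 ≤ e ^ 12 :=
      (pow_le_pow_left₀ hQ0 hQ 2).trans (pow_le_pow_right₀ he1 (by norm_num))
    have hc : 1 ≤ e ^ 12 := one_le_pow₀ he1
    linarith
  have h5 : y ^ 2 ≤ e ^ 2 := by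
    refine pow_le_pow_left₀ hy0 (hy.trans (Real.exp_le_exp.mpr ?_)) 2
    linarith
  have h6 : 192 * u ≤ e ^ 6 := by
    have := Real.quadratic_le_exp_of_nonneg (show 0 ≤ (6 : ℕ) * (u / 20) by positivity)
    rw [Real.exp_nat_mul] at this
    push_cast at this
    nlinarith
  have h7 : x = e ^ 20 := by
    rw [hx, he, ← Real.exp_nat_mul]
    congr 1
    push_cast
    ring
  have h8 : y ^ 2 * ((5 * LY + 1) ^ 2 / L ^ 2 + 2 * Q ^ 12 + Q ^ 2 + 2) ≤ x / (32 * u) := by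
    calc y ^ 2 * ((5 * LY + 1) ^ 2 / L ^ 2 + 2 * Q ^ 12 + Q ^ 2 + 2)
        ≤ y ^ 2 * (14400 / v ^ 18 + 2 * Q ^ 12 + Q ^ 2 + 2) := by gcongr
      _ ≤ e ^ 2 * (6 * e ^ 12) := by gcongr
      _ ≤ x / (32 * u) := by
          rw [le_div_iff₀ (by positivity), h7]
          calc e ^ 2 * (6 * e ^ 12) * (32 * u) = e ^ 14 * (192 * u) := by ring
            _ ≤ e ^ 14 * e ^ 6 := by gcongr
            _ = e ^ 20 := by ring
  have h9 : x / (16 * u) = x / (32 * u) + x / (32 * u) := by field_simp; norm_num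
  linarith

open Finset in
theorem exists_mul_sum_inv_le_S : ∃ V : ℝ, 21 ≤ V ∧ ∀ v : ℝ, V ≤ v → ∀ K : Finset ℕ,
    K ⊆ Icc 1 ⌊Real.exp v⌋₊ → (∀ h ∈ K, HadamardOrder h) → 1 ∈ K →
    Real.exp (v ^ 10) / (16 * v ^ 10) * ∑ h ∈ K, (h : ℝ)⁻¹ ≤ S (Real.exp (v ^ 10)) := by
  obtain ⟨N, hN⟩ := exists_sum_card_primeMultiples_ge
  refine ⟨max 21 N, le_max_left _ _, fun v hv K hK hKH hK1 => ?_⟩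
  have hv21 : 21 ≤ v := (le_max_left _ _).trans hv
  have hvN : N ≤ v := (le_max_right _ _).trans hv
  set x := Real.exp (v ^ 10) with hx
  set Y := ⌊Real.exp v⌋₊ with hYdef
  set Q := ⌊Real.exp (v ^ 10 / 20)⌋₊ with hQdef
  have hY1 : 1 ≤ Y := (Nat.one_le_floor_iff _).mpr (Real.one_le_exp (by linarith))
  have hQ0 : 0 < Q := (Nat.one_le_floor_iff _).mpr (Real.one_le_exp (by positivity))
  have hYle : (Y : ℝ) ≤ Real.exp v := Nat.floor_le (Real.exp_pos _).le
  have hY1' : (1 : ℝ) ≤ Y := by exact_mod_cast hY1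
  have hNY : N * Y ≤ x := by
    calc N * Y ≤ Real.exp v * Real.exp v := by
          have := Real.add_one_le_exp v
          gcongr
          linarith
      _ = Real.exp (v + v) := (Real.exp_add v v).symm
      _ ≤ x := by
          refine Real.exp_le_exp.mpr ?_
          have h1 : (21 : ℝ) ^ 9 * v ≤ v ^ 9 * v := by gcongr
          have h2 : v ^ 9 * v = v ^ 10 := by ring
          linarith
  have hmain := hN x Y K hY1 hNY hK
  have hcoll := (sum_erase_card_inter_le (X := ⌊x⌋₊) hQ0 hK).trans
    (collision_bound_le hv21 hx (Nat.floor_le (Real.exp_pos _).le)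
      (Real.log_nonneg hY1')
      ((Real.log_le_log (by linarith) hYle).trans (Real.log_exp v).le)
      (by
        rw [← Real.log_exp (v ^ 10 / 20)]
        exact Real.log_le_log (Real.exp_pos _) (Nat.lt_floor_add_one _).le)
      (Nat.cast_nonneg _) hYle (Nat.cast_nonneg _) (Nat.floor_le (Real.exp_pos _).le))
  have hunion := (sum_card_le_card_biUnion_add K (primeMultiples ⌊x⌋₊)).trans
    (Nat.add_le_add_right (card_le_S (x := x) fun n hn => by
      obtain ⟨h, hh, hn⟩ := mem_biUnion.mp hn
      exact (hKH h hh).of_mem_primeMultiples (mem_Icc.mp (hK hh)).1 hn) _)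
  have hunion' := (Nat.cast_le (α := ℝ)).mpr hunion
  rw [Nat.cast_add] at hunion'
  have hT : 1 ≤ ∑ h ∈ K, (h : ℝ)⁻¹ := by
    have := single_le_sum (f := fun h : ℕ => (h : ℝ)⁻¹) (fun h _ => by positivity) hK1
    simpa using this
  set T := ∑ h ∈ K, (h : ℝ)⁻¹
  have hxv : 0 ≤ x / (16 * v ^ 10) := by positivity
  have hlx : Real.log x = v ^ 10 := Real.log_exp _
  rw [hlx] at hmain
  have h2 : x / (8 * v ^ 10) = 2 * (x / (16 * v ^ 10)) := by field_simp; ring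
  rw [h2] at hmain
  nlinarith

/-! ### Bootstrapping -/

open Finset in
lemma sum_card_filter_div_le (K : Finset ℕ) (hK : ∀ h ∈ K, 0 < h) (a b : ℕ) :
    ∑ n ∈ Ico a b, ((K.filter (· ≤ n)).card : ℝ) / (n * (n + 1)) ≤ ∑ h ∈ K, (h : ℝ)⁻¹ := by
  have h1 : ∀ n ∈ Ico a b, ((K.filter (· ≤ n)).card : ℝ) / (n * (n + 1)) =
      ∑ h ∈ K, if h ≤ n then (1 : ℝ) / (n * (n + 1)) else 0 := fun n _ => by
    rw [← sum_filter, sum_const, nsmul_eq_mul, mul_one_div]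
  rw [sum_congr rfl h1, sum_comm]
  refine sum_le_sum fun h hh => ?_
  have hh0 : (0 : ℝ) < h := by exact_mod_cast hK h hh
  rw [← sum_filter]
  calc ∑ n ∈ (Ico a b).filter (h ≤ ·), (1 : ℝ) / (n * (n + 1))
      ≤ ∑ n ∈ Ico h (max h b), (1 : ℝ) / (n * (n + 1)) :=
        sum_le_sum_of_subset_of_nonneg (fun n hn => by
          simp only [mem_filter, mem_Ico] at hn ⊢
          exact ⟨hn.2, lt_max_of_lt_right hn.1.2⟩) fun n _ _ => by positivity
    _ = ∑ n ∈ Ico h (max h b), (-((n + 1 : ℕ) : ℝ)⁻¹ - -(n : ℝ)⁻¹) := by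
        refine sum_congr rfl fun n hn => ?_
        have hn0 : (0 : ℝ) < n := hh0.trans_le (by exact_mod_cast (mem_Ico.mp hn).1)
        push_cast
        field_simp
        ring
    _ = (h : ℝ)⁻¹ - ((max h b : ℕ) : ℝ)⁻¹ := by
        rw [sum_Ico_sub (fun n : ℕ => -(n : ℝ)⁻¹) (le_max_left h b)]
        ring
    _ ≤ (h : ℝ)⁻¹ := sub_le_self _ (by positivity)

open Classical in
lemma S_natCast_le {Y n : ℕ} (hn : n ≤ Y) :
    S n ≤ (((Finset.Icc 1 Y).filter HadamardOrder).filter (· ≤ n)).card := by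
  rw [S, ← Set.ncard_coe_finset]
  refine Set.ncard_le_ncard (fun m hm => ?_) (Finset.finite_toSet _)
  obtain ⟨h1, h2, h3⟩ := hm
  have h2' : m ≤ n := by exact_mod_cast h2
  simp only [Finset.coe_filter, Finset.mem_filter, Finset.mem_Icc, Set.mem_ofPred_eq]
  exact ⟨⟨⟨h1, h2'.trans hn⟩, h3⟩, h2'⟩

open Finset in
lemma log_log_sub_le_sum {a b : ℕ} (ha : 2 ≤ a) (hab : a ≤ b) :
    Real.log (Real.log b) - Real.log (Real.log a) ≤
      2 * ∑ n ∈ Ico a b, 1 / (((n : ℝ) + 1) * Real.log n) := by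
  rw [← sum_Ico_sub (fun n : ℕ => Real.log (Real.log n)) hab, mul_sum]
  refine sum_le_sum fun n hn => ?_
  have hn2 : (2 : ℝ) ≤ n := by exact_mod_cast ha.trans (mem_Ico.mp hn).1
  have hL : 0 < Real.log n := Real.log_pos (by linarith)
  have hL' : 0 < Real.log ((n : ℝ) + 1) := Real.log_pos (by linarith)
  push_cast
  have h1 : Real.log ((n : ℝ) + 1) - Real.log n ≤ 1 / n := by
    rw [← Real.log_div (by positivity) (by positivity)]
    refine (Real.log_le_sub_one_of_pos (by positivity)).trans (le_of_eq ?_)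
    field_simp
    ring
  have h2 : Real.log (Real.log ((n : ℝ) + 1)) - Real.log (Real.log n) ≤
      (Real.log ((n : ℝ) + 1) - Real.log n) / Real.log n := by
    rw [← Real.log_div hL'.ne' hL.ne']
    refine (Real.log_le_sub_one_of_pos (by positivity)).trans (le_of_eq ?_)
    field_simp
  calc _ ≤ (1 / (n : ℝ)) / Real.log n := h2.trans (by gcongr)
    _ ≤ (2 / ((n : ℝ) + 1)) / Real.log n := by
        gcongr ?_ / _
        rw [div_le_div_iff₀ (by positivity) (by positivity)]
        linarith
    _ = 2 * (1 / (((n : ℝ) + 1) * Real.log n)) := by field_simp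

open Classical in
lemma mul_log_pow_le_sum_inv {c U : ℝ} {j : ℕ} (hc : 0 ≤ c)
    (hU : ∀ u, U ≤ u → c * (Real.exp u / u * Real.log u ^ j) ≤ S (Real.exp u))
    {v : ℝ} (hv : 100 ≤ v) (hUv : U ≤ √v) :
    c / 2 ^ j / 8 * Real.log v ^ (j + 1) ≤
      ∑ h ∈ (Finset.Icc 1 ⌊Real.exp v⌋₊).filter HadamardOrder, (h : ℝ)⁻¹ := by
  set Y := ⌊Real.exp v⌋₊ with hY
  set K := (Finset.Icc 1 Y).filter HadamardOrder with hK
  set a := ⌊Real.exp √v⌋₊ + 1 with ha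
  have hlogv : 4 * Real.log 2 ≤ Real.log v := by
    have : Real.log ((2 : ℝ) ^ 4) ≤ Real.log v := Real.log_le_log (by norm_num) (by linarith)
    rw [Real.log_pow] at this
    exact_mod_cast this
  have hl2 : 0 < Real.log 2 := Real.log_pos (by norm_num)
  have hsq : 10 ≤ √v := Real.le_sqrt_of_sq_le (by linarith)
  have hsv : √v ^ 2 = v := Real.sq_sqrt (by linarith)
  have ha_lt : Real.exp √v < a := by
    rw [ha]; push_cast; exact Nat.lt_floor_add_one _
  have ha_le : (a : ℝ) ≤ Real.exp (√v + 1) := by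
    have h1 := Nat.floor_le (Real.exp_pos √v).le
    have h2 : 1 ≤ Real.exp √v := Real.one_le_exp (by linarith)
    have h3 := Real.add_one_le_exp (1 : ℝ)
    rw [ha, Real.exp_add]
    push_cast
    nlinarith
  have ha2 : 2 ≤ a := by
    have : 1 ≤ ⌊Real.exp √v⌋₊ := (Nat.one_le_floor_iff _).mpr (Real.one_le_exp (by linarith))
    omega
  have haY : a ≤ Y + 1 := by
    have : ⌊Real.exp √v⌋₊ ≤ ⌊Real.exp v⌋₊ :=
      Nat.floor_le_floor (Real.exp_le_exp.mpr (by nlinarith))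
    omega
  have hloga : Real.log (Real.log a) ≤ 3 / 4 * Real.log v := by
    have h1 : Real.log a ≤ 2 * √v := by
      have := Real.log_le_log (by positivity) ha_le
      rw [Real.log_exp] at this
      linarith
    have h2 : 0 < Real.log a := Real.log_pos (by exact_mod_cast ha2)
    have h3 := Real.log_le_log h2 h1
    rw [Real.log_mul (by norm_num) (by positivity), Real.log_sqrt (by linarith)] at h3
    linarith
  have hlogY : Real.log v ≤ Real.log (Real.log (Y + 1 : ℕ)) := by
    refine Real.log_le_log (by linarith) ?_
    rw [← Real.log_exp v]
    refine Real.log_le_log (Real.exp_pos _) ?_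
    push_cast
    exact (Nat.lt_floor_add_one _).le
  have hsum := log_log_sub_le_sum ha2 haY
  have hterm : ∀ n ∈ Finset.Ico a (Y + 1),
      c / 2 ^ j * Real.log v ^ j * (1 / (((n : ℝ) + 1) * Real.log n)) ≤
        ((K.filter (· ≤ n)).card : ℝ) / (n * (n + 1)) := by
    intro n hn
    obtain ⟨han, hnY⟩ := Finset.mem_Ico.mp hn
    have han' : Real.exp √v < n := ha_lt.trans_le (by exact_mod_cast han)
    have hn0 : (0 : ℝ) < n := (Real.exp_pos _).trans han'
    have hln : √v ≤ Real.log n := ((Real.lt_log_iff_exp_lt hn0).mpr han').le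
    have hln0 : 0 < Real.log n := by linarith
    have hS := hU (Real.log n) (hUv.trans hln)
    rw [Real.exp_log hn0] at hS
    have hlln : Real.log v / 2 ≤ Real.log (Real.log n) := by
      rw [← Real.log_sqrt (by linarith)]
      exact Real.log_le_log (by linarith) hln
    have hpow : (Real.log v / 2) ^ j ≤ Real.log (Real.log n) ^ j :=
      pow_le_pow_left₀ (by linarith) hlln j
    have hSK : (S n : ℝ) ≤ (K.filter (· ≤ n)).card := by
      exact_mod_cast S_natCast_le (Nat.lt_succ_iff.mp hnY)
    rw [le_div_iff₀ (by positivity)]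
    refine le_trans ?_ (hS.trans hSK)
    calc c / 2 ^ j * Real.log v ^ j * (1 / (((n : ℝ) + 1) * Real.log n)) * (n * (n + 1))
        = c * (n / Real.log n * (Real.log v / 2) ^ j) := by
          rw [div_pow]; field_simp
      _ ≤ _ := by gcongr
  have hfin := (Finset.sum_le_sum hterm).trans (sum_card_filter_div_le K
    (fun h hh => (Finset.mem_Icc.mp (Finset.mem_filter.mp hh).1).1) a (Y + 1))
  rw [← Finset.mul_sum] at hfin
  refine le_trans ?_ hfin
  calc c / 2 ^ j / 8 * Real.log v ^ (j + 1)
      = c / 2 ^ j * Real.log v ^ j * (Real.log v / 8) := by rw [pow_succ]; ring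
    _ ≤ _ := by
        have : 0 ≤ Real.log v := by linarith
        gcongr
        linarith

lemma exists_pow_ten_eq {u : ℝ} (hu : 0 < u) :
    ∃ v : ℝ, 0 < v ∧ v ^ 10 = u ∧ Real.log v = Real.log u / 10 := by
  refine ⟨Real.exp (Real.log u / 10), Real.exp_pos _, ?_, Real.log_exp _⟩
  rw [← Real.exp_nat_mul]
  push_cast
  rw [mul_div_cancel₀ _ (by norm_num), Real.exp_log hu]

theorem exists_mul_log_pow_le_S (j : ℕ) : ∃ c U : ℝ, 0 < c ∧
    ∀ u, U ≤ u → c * (Real.exp u / u * Real.log u ^ j) ≤ S (Real.exp u) := by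
  classical
  obtain ⟨V, hV21, hV⟩ := exists_mul_sum_inv_le_S
  have hV' : ∀ u, V ^ 10 ≤ u → ∀ v, 0 < v → v ^ 10 = u → V ≤ v := fun u hu v hv huv =>
    le_of_not_gt fun h => absurd (pow_lt_pow_left₀ h hv.le (by norm_num : 10 ≠ 0)) (by linarith)
  induction j with
  | zero =>
    refine ⟨1 / 16, V ^ 10, by norm_num, fun u hu => ?_⟩
    have hu0 : 0 < u := lt_of_lt_of_le (by positivity) hu
    obtain ⟨v, hv0, hvu, -⟩ := exists_pow_ten_eq hu0
    have h1 := hV v (hV' u hu v hv0 hvu) {1}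
      (by
        rw [Finset.singleton_subset_iff, Finset.mem_Icc]
        exact ⟨le_rfl, (Nat.one_le_floor_iff _).mpr (Real.one_le_exp hv0.le)⟩)
      (by simpa using hadamardOrder_one) (Finset.mem_singleton_self 1)
    rw [hvu, Finset.sum_singleton] at h1
    refine le_trans (le_of_eq ?_) h1
    field_simp
    simp
  | succ j ih =>
    obtain ⟨c, U, hc, hU⟩ := ih
    set W := max (max V 100) (U ^ 2) with hW
    refine ⟨c / 2 ^ j / 8 / 16 / 10 ^ (j + 1), W ^ 10, by positivity, fun u hu => ?_⟩
    have hWV : V ≤ W := (le_max_left _ _).trans (le_max_left _ _)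
    have hW100 : 100 ≤ W := (le_max_right _ _).trans (le_max_left _ _)
    have hu0 : 0 < u := lt_of_lt_of_le (by positivity) hu
    obtain ⟨v, hv0, hvu, hlog⟩ := exists_pow_ten_eq hu0
    have hWv : W ≤ v := le_of_not_gt fun h =>
      absurd (pow_lt_pow_left₀ h hv0.le (by norm_num : 10 ≠ 0)) (by linarith)
    have hsum := mul_log_pow_le_sum_inv hc.le hU (hW100.trans hWv)
      (Real.le_sqrt_of_sq_le ((le_max_right _ _).trans hWv))
    have h1 := hV v (hWV.trans hWv) ((Finset.Icc 1 ⌊Real.exp v⌋₊).filter HadamardOrder)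
      (Finset.filter_subset _ _) (fun h hh => (Finset.mem_filter.mp hh).2)
      (Finset.mem_filter.mpr ⟨Finset.mem_Icc.mpr
        ⟨le_rfl, (Nat.one_le_floor_iff _).mpr (Real.one_le_exp hv0.le)⟩, hadamardOrder_one⟩)
    rw [hvu] at h1
    refine le_trans ?_ h1
    calc c / 2 ^ j / 8 / 16 / 10 ^ (j + 1) * (Real.exp u / u * Real.log u ^ (j + 1))
        = Real.exp u / (16 * u) * (c / 2 ^ j / 8 * Real.log v ^ (j + 1)) := by
          rw [hlog, div_pow]; field_simp
      _ ≤ _ := by gcongr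

theorem hadamard_count_erdos_lower :
    ∀ ε : ℝ, ε > 0 → ∃ x₀ : ℝ, ∀ x : ℝ, x ≥ x₀ →
      (S x : ℝ) ≥ (1 - ε) * x * Real.log (Real.log x) / Real.log x := by
  intro ε hε
  obtain ⟨c, U, hc, hU⟩ := exists_mul_log_pow_le_S 2
  refine ⟨Real.exp (max U (Real.exp (1 / c))), fun x hx => ?_⟩
  have hx0 : 0 < x := (Real.exp_pos _).trans_le hx
  have hlx : max U (Real.exp (1 / c)) ≤ Real.log x := (Real.le_log_iff_exp_le hx0).mpr hx
  have hL : 0 < Real.log x := (Real.exp_pos _).trans_le ((le_max_right _ _).trans hlx)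
  have hLL : 1 / c ≤ Real.log (Real.log x) :=
    (Real.le_log_iff_exp_le hL).mpr ((le_max_right _ _).trans hlx)
  have h1 := hU (Real.log x) ((le_max_left _ _).trans hlx)
  rw [Real.exp_log hx0] at h1
  refine le_trans ?_ h1
  have hLL0 : 0 < Real.log (Real.log x) := lt_of_lt_of_le (by positivity) hLL
  rw [div_le_iff₀ hc] at hLL
  have h2 : 1 - ε ≤ Real.log (Real.log x) * c := by linarith
  calc (1 - ε) * x * Real.log (Real.log x) / Real.log x
      = (1 - ε) * (x * Real.log (Real.log x) / Real.log x) := by ring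
    _ ≤ Real.log (Real.log x) * c * (x * Real.log (Real.log x) / Real.log x) := by gcongr
    _ = c * (x / Real.log x * Real.log (Real.log x) ^ 2) := by ring
end

section
/- Let 𝒢 be a set of positive integers with counting function satisfying G(x) = O(x^α) for some α ∈ (0,1), and let 𝓜 be the multiplicative monoid generated by 𝒢 (the set of all finite products of elements of 𝒢, including the empty product 1). Then for every ε > 0, M(x) = O(x^{α+ε}). -/
/-- A (multiplicative) monoid of natural numbers: a set of positive integers
containing `1` and closed under multiplication. -/
def IsNatMonoid (A : Set ℕ) : Prop :=
  (∀ a ∈ A, 0 < a) ∧ 1 ∈ A ∧ ∀ a ∈ A, ∀ b ∈ A, a * b ∈ A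

/-- The counting function of a set of natural numbers:
`count A x = #{n ∈ A : n ≤ x}`. -/
noncomputable def count (A : Set ℕ) (x : ℝ) : ℕ :=
  {n : ℕ | n ∈ A ∧ (n : ℝ) ≤ x}.ncard

open scoped ENNReal in
theorem tsum_closure_insert_le (φ : ℕ →* ℝ≥0∞) (g : ℕ) (F : Set ℕ) :
    ∑' n : Submonoid.closure (insert g F), φ n ≤
      (∑' k : ℕ, φ g ^ k) * ∑' n : Submonoid.closure F, φ n := by
  have hg : g ∈ Submonoid.closure (insert g F) := Submonoid.subset_closure (Set.mem_insert _ _)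
  have hF : Submonoid.closure F ≤ Submonoid.closure (insert g F) :=
    Submonoid.closure_mono (Set.subset_insert _ _)
  let p : ℕ × Submonoid.closure F → Submonoid.closure (insert g F) :=
    fun q ↦ ⟨g ^ q.1 * q.2, mul_mem (pow_mem hg _) (hF q.2.2)⟩
  have hp : Function.Surjective p := by
    rintro ⟨n, hn⟩
    rw [Set.insert_eq, Submonoid.closure_union, Submonoid.mem_sup] at hn
    obtain ⟨y, hy, z, hz, rfl⟩ := hn
    obtain ⟨k, rfl⟩ := Submonoid.mem_closure_singleton.1 hy
    exact ⟨(k, ⟨z, hz⟩), rfl⟩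
  refine (ENNReal.tsum_le_tsum_comp_of_surjective hp fun n ↦ φ n).trans_eq ?_
  rw [ENNReal.tsum_prod (f := fun k n ↦ φ (p (k, n))), ← ENNReal.tsum_mul_right]
  refine tsum_congr fun k ↦ ?_
  rw [← ENNReal.tsum_mul_left]
  exact tsum_congr fun n ↦ by simp [p]

open scoped ENNReal in
theorem tsum_closure_finset_le (φ : ℕ →* ℝ≥0∞) (F : Finset ℕ) :
    ∑' n : Submonoid.closure (F : Set ℕ), φ n ≤ ∏ g ∈ F, ∑' k : ℕ, φ g ^ k := by
  induction F using Finset.induction_on with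
  | empty =>
    rw [Finset.coe_empty, Submonoid.closure_empty, tsum_eq_single (1 : (⊥ : Submonoid ℕ))
      fun n hn ↦ absurd (Subtype.ext (Submonoid.mem_bot.1 n.2)) hn]
    simp
  | insert g F hg ih =>
    rw [Finset.coe_insert, Finset.prod_insert hg]
    exact (tsum_closure_insert_le φ g F).trans (by gcongr)

/-- The completely multiplicative function `n ↦ n ^ (-s)`, with extended nonnegative values. -/
noncomputable def negRpowHom (s : ℝ) : ℕ →* ENNReal where
  toFun n := ENNReal.ofReal ((n : ℝ) ^ (-s))
  map_one' := by simp
  map_mul' m n := by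
    rw [← ENNReal.ofReal_mul (by positivity), Nat.cast_mul, Real.mul_rpow (by simp) (by simp)]

theorem one_sub_inv_le_exp {t b : ℝ} (ht : 0 ≤ t) (htb : t ≤ b) (hb : b < 1) :
    (1 - t)⁻¹ ≤ Real.exp (t / (1 - b)) := by
  have h1 : (1 - t)⁻¹ = 1 + t / (1 - t) := by
    have : 1 - t ≠ 0 := by linarith
    field_simp
    ring
  have h2 : t / (1 - t) ≤ t / (1 - b) :=
    div_le_div_of_nonneg_left ht (by linarith) (by linarith)
  linarith [Real.add_one_le_exp (t / (1 - b))]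

theorem tsum_negRpowHom_pow_le {s : ℝ} (hs : 0 < s) {g : ℕ} (hg : 2 ≤ g) :
    ∑' k : ℕ, negRpowHom s g ^ k ≤
      ENNReal.ofReal (Real.exp ((g : ℝ) ^ (-s) / (1 - 2 ^ (-s)))) := by
  have hb : (2 : ℝ) ^ (-s) < 1 := Real.rpow_lt_one_of_one_lt_of_neg (by norm_num) (by linarith)
  have hgb : (g : ℝ) ^ (-s) ≤ 2 ^ (-s) :=
    Real.rpow_le_rpow_of_nonpos (by norm_num) (by exact_mod_cast hg) (by linarith)
  rw [ENNReal.tsum_geometric]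
  change (1 - ENNReal.ofReal ((g : ℝ) ^ (-s)))⁻¹ ≤ _
  rw [← ENNReal.ofReal_one, ← ENNReal.ofReal_sub _ (by positivity),
    ← ENNReal.ofReal_inv_of_pos (by linarith)]
  exact ENNReal.ofReal_le_ofReal (one_sub_inv_le_exp (by positivity) hgb hb)

theorem finite_setOf_mem_and_cast_le (A : Set ℕ) (x : ℝ) :
    {n : ℕ | n ∈ A ∧ (n : ℝ) ≤ x}.Finite :=
  (Set.finite_Iic ⌊x⌋₊).subset fun _ hn ↦ Nat.le_floor hn.2

theorem count_mono (A : Set ℕ) : Monotone (count A) := fun _ y hxy ↦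
  Set.ncard_le_ncard (fun _ hn ↦ ⟨hn.1, hn.2.trans hxy⟩) (finite_setOf_mem_and_cast_le A y)

theorem count_strictMonoOn (A : Set ℕ) : StrictMonoOn (fun n : ℕ ↦ count A n) A := by
  intro a _ b hb hab
  refine Set.ncard_lt_ncard ⟨fun n hn ↦ ⟨hn.1, hn.2.trans (by exact_mod_cast hab.le)⟩, ?_⟩
    (finite_setOf_mem_and_cast_le A b)
  intro h
  have h' : (b : ℝ) ≤ a := (h ⟨hb, le_rfl⟩).2
  exact absurd hab (by exact_mod_cast h'.not_gt)

theorem summable_rpow_neg_of_count_le {G : Set ℕ} (hG : ∀ g ∈ G, 0 < g) {α c x₀ s : ℝ}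
    (hα : 0 < α) (hs : α < s) (hc : 0 < c)
    (h : ∀ x : ℝ, x ≥ x₀ → (count G x : ℝ) ≤ c * x ^ α) :
    Summable fun g : G ↦ ((g : ℕ) : ℝ) ^ (-s) := by
  have hbound : ∀ g ∈ G, (count G g : ℝ) ≤ (c + count G x₀) * (g : ℝ) ^ α := by
    intro g hg
    have h1 : (1 : ℝ) ≤ (g : ℝ) ^ α := Real.one_le_rpow (by exact_mod_cast hG g hg) hα.le
    have h0 : (0 : ℝ) ≤ count G x₀ := by positivity
    rcases le_total x₀ g with hx | hx
    · nlinarith [h g hx]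
    · have : (count G g : ℝ) ≤ count G x₀ := by exact_mod_cast count_mono G hx
      nlinarith
  set C : ℝ := c + count G x₀
  have hC : 0 < C := by positivity
  have hsum : Summable fun n : ℕ ↦ (C ^ (s / α)) * (n : ℝ) ^ (-(s / α)) :=
    (Real.summable_nat_rpow.2 (neg_lt_neg ((one_lt_div hα).2 hs))).mul_left _
  have hinj : Function.Injective fun g : G ↦ count G (g : ℕ) :=
    fun a b hab ↦ Subtype.ext ((count_strictMonoOn G).injOn a.2 b.2 hab)
  refine Summable.of_nonneg_of_le (fun _ ↦ by positivity) (fun g ↦ ?_) (hsum.comp_injective hinj)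
  have hpos : 0 < count G (g : ℕ) :=
    (Set.ncard_pos (finite_setOf_mem_and_cast_le G _)).2 ⟨g, g.2, le_rfl⟩
  have hpos' : (0 : ℝ) < count G (g : ℕ) := by exact_mod_cast hpos
  have hg : (0 : ℝ) < (g : ℕ) := by exact_mod_cast hG g g.2
  have hsα : 0 < s / α := div_pos (hα.trans hs) hα
  have h2 := Real.rpow_le_rpow hpos'.le (hbound g g.2) hsα.le
  rw [Real.mul_rpow hC.le (by positivity), ← Real.rpow_mul hg.le,
    mul_div_cancel₀ _ hα.ne'] at h2
  change _ ≤ C ^ (s / α) * (count G (g : ℕ) : ℝ) ^ (-(s / α))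
  rw [Real.rpow_neg hg.le, Real.rpow_neg hpos'.le, ← div_eq_mul_inv,
    le_div_iff₀ (by positivity), inv_mul_le_iff₀ (by positivity)]
  linarith

open Classical in
theorem mem_closure_filter_Icc {G : Set ℕ} (hG : ∀ g ∈ G, 0 < g) {n : ℕ}
    (hn : n ∈ Submonoid.closure G) :
    0 < n ∧ ∀ N, n ≤ N →
      n ∈ Submonoid.closure (((Finset.Icc 2 N).filter (· ∈ G) : Finset ℕ) : Set ℕ) := by
  induction hn using Submonoid.closure_induction with
  | mem g hg =>
    refine ⟨hG g hg, fun N hN ↦ ?_⟩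
    rcases eq_or_lt_of_le (Nat.succ_le_of_lt (hG g hg)) with rfl | h
    · exact one_mem _
    · exact Submonoid.subset_closure (by simp [hg, hN]; omega)
  | one => exact ⟨one_pos, fun _ _ ↦ one_mem _⟩
  | mul a b _ _ ha hb =>
    exact ⟨Nat.mul_pos ha.1 hb.1, fun N hN ↦ mul_mem
      (ha.2 N ((Nat.le_mul_of_pos_right a hb.1).trans hN))
      (hb.2 N ((Nat.le_mul_of_pos_left b ha.1).trans hN))⟩

open Classical in
theorem count_closure_le {G : Set ℕ} (hG : ∀ g ∈ G, 0 < g) {s : ℝ} (hs : 0 < s)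
    (hsum : Summable fun g : G ↦ ((g : ℕ) : ℝ) ^ (-s)) {x : ℝ} (hx : 0 ≤ x) :
    (count (↑(Submonoid.closure G)) x : ℝ) ≤
      Real.exp ((∑' g : G, ((g : ℕ) : ℝ) ^ (-s)) / (1 - 2 ^ (-s))) * x ^ s := by
  have hb : (2 : ℝ) ^ (-s) < 1 := Real.rpow_lt_one_of_one_lt_of_neg (by norm_num) (by linarith)
  set F : Finset ℕ := (Finset.Icc 2 ⌊x⌋₊).filter (· ∈ G) with hF
  have hfin := finite_setOf_mem_and_cast_le (↑(Submonoid.closure G)) x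
  set T := hfin.toFinset with hT
  have hTmem : ∀ n ∈ T, n ∈ Submonoid.closure G ∧ (n : ℝ) ≤ x := fun n hn ↦ by
    simpa [hT] using hn
  have hFsum : ∑ g ∈ F, (g : ℝ) ^ (-s) ≤ ∑' g : G, ((g : ℕ) : ℝ) ^ (-s) := by
    rw [← Finset.sum_subtype_of_mem (p := (· ∈ G)) (fun g : ℕ ↦ (g : ℝ) ^ (-s))
      (fun g hg ↦ (Finset.mem_filter.1 hg).2)]
    exact hsum.sum_le_tsum _ fun _ _ ↦ by positivity
  have hTF : ∑ n ∈ T, negRpowHom s n ≤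
      ∑' n : Submonoid.closure (F : Set ℕ), negRpowHom s n := by
    rw [← Finset.sum_subtype_of_mem (p := (· ∈ Submonoid.closure (F : Set ℕ))) (negRpowHom s)
      (fun n hn ↦ (mem_closure_filter_Icc hG (hTmem n hn).1).2 _ (Nat.le_floor (hTmem n hn).2))]
    exact ENNReal.sum_le_tsum _
  have hprod : ∏ g ∈ F, ∑' k : ℕ, negRpowHom s g ^ k ≤
      ENNReal.ofReal (Real.exp ((∑' g : G, ((g : ℕ) : ℝ) ^ (-s)) / (1 - 2 ^ (-s)))) := by
    refine (Finset.prod_le_prod' fun g hg ↦ tsum_negRpowHom_pow_le hs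
      (Finset.mem_Icc.1 (Finset.mem_filter.1 hg).1).1).trans ?_
    rw [← ENNReal.ofReal_prod_of_nonneg fun _ _ ↦ (Real.exp_pos _).le, ← Real.exp_sum,
      ← Finset.sum_div]
    have : 0 ≤ 1 - (2 : ℝ) ^ (-s) := by linarith
    gcongr
  have hreal : ∑ n ∈ T, (n : ℝ) ^ (-s) ≤
      Real.exp ((∑' g : G, ((g : ℕ) : ℝ) ^ (-s)) / (1 - 2 ^ (-s))) := by
    rw [← ENNReal.ofReal_le_ofReal_iff (Real.exp_pos _).le,
      ENNReal.ofReal_sum_of_nonneg fun _ _ ↦ by positivity]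
    exact (hTF.trans (tsum_closure_finset_le _ F)).trans hprod
  calc (count (↑(Submonoid.closure G)) x : ℝ) = ∑ n ∈ T, (1 : ℝ) := by
        rw [count, Set.ncard_eq_toFinset_card _ hfin]
        simp [hT]
    _ ≤ ∑ n ∈ T, (n : ℝ) ^ (-s) * x ^ s := by
        refine Finset.sum_le_sum fun n hn ↦ ?_
        have hn0 : (0 : ℝ) < n := by
          exact_mod_cast (mem_closure_filter_Icc hG (hTmem n hn).1).1
        rw [Real.rpow_neg hn0.le, le_inv_mul_iff₀ (by positivity), mul_one]
        exact Real.rpow_le_rpow hn0.le (hTmem n hn).2 hs.le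
    _ ≤ _ := by
        rw [← Finset.sum_mul]
        gcongr

theorem generated_monoid_count_big_O (G : Set ℕ) (hG : ∀ g ∈ G, 0 < g)
    (α : ℝ) (hα : α ∈ Set.Ioo (0 : ℝ) 1)
    (hGO : ∃ c : ℝ, c > 0 ∧ ∃ x₀ : ℝ, ∀ x : ℝ, x ≥ x₀ → (count G x : ℝ) ≤ c * x ^ α) :
    ∀ ε : ℝ, ε > 0 → ∃ c : ℝ, c > 0 ∧ ∃ x₀ : ℝ, ∀ x : ℝ, x ≥ x₀ →
      (count (↑(Submonoid.closure G)) x : ℝ) ≤ c * x ^ (α + ε) := by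
  obtain ⟨c, hc, x₀, h⟩ := hGO
  intro ε hε
  have hs : 0 < α + ε := add_pos hα.1 hε
  exact ⟨_, Real.exp_pos _, 0, fun x hx ↦ count_closure_le hG hs
    (summable_rpow_neg_of_count_le hG hα.1 (by linarith) hc h) hx⟩
end
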